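/- arXiv:2403.19187 — 10 statements merged into one kernel-verified Lean document; each statement's English description precedes it below -/
import Mathlib

section
/- Let n ≥ 2 and let Q be an n-quasigroup in operational form, i.e. a type Q with operations f : (Fin n → Q) → Q and g : Fin n → (Fin n → Q) → Q satisfying, for all x : Fin n → Q and i : Fin n, f (Function.update x i (g i x)) = x i and g i (Function.update x i (f x)) = x i. Then for all x : Fin n → Q and all i j : Fin n with i ≠ j, one has g i (Function.update (Function.update x i (x j)) j (g j x)) = x i. -/
/-- In an n-quasigroup in operational form (n ≥ 2), identities (2.7)/(2.8) hold. -/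
theorem stmt_1 (n : ℕ) (hn : 2 ≤ n) (Q : Type*)
    (f : (Fin n → Q) → Q) (g : Fin n → (Fin n → Q) → Q)
    (h23 : ∀ (x : Fin n → Q) (i : Fin n), f (Function.update x i (g i x)) = x i)
    (h24 : ∀ (x : Fin n → Q) (i : Fin n), g i (Function.update x i (f x)) = x i) :
    ∀ (x : Fin n → Q) (i j : Fin n), i ≠ j →
      g i (Function.update (Function.update x i (x j)) j (g j x)) = x i := by
  intro x i j hij
  have h := h24 (Function.update x j (g j x)) i
  rw [h23, Function.update_of_ne hij, Function.update_comm hij.symm] at h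
  exact h
end

section
/- The variety of n-quasigroups satisfies the strong amalgamation property: let n ≥ 1, let A, B, C be n-quasigroups, and let φ : A → B and ψ : A → C be injective homomorphisms. Then there exist an n-quasigroup D and injective homomorphisms β : B → D and γ : C → D such that β ∘ φ = γ ∘ ψ and, for all b : B and c : C, if β b = γ c then there exists a : A with b = φ a and c = ψ a. -/
universe u

def QUniq {ι X : Type*} (R : Set (ι → X)) : Prop :=
  ∀ x ∈ R, ∀ y ∈ R, ∀ i, (∀ j, j ≠ i → x j = y j) → x = y

def QTotal {ι X : Type*} (R : Set (ι → X)) : Prop :=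
  ∀ (x : ι → X) (i : ι), ∃ y ∈ R, ∀ j, j ≠ i → y j = x j

inductive QT (ι : Type) (P : Type u) : Type u
  | base (p : P) : QT ι P
  | node (i : ι) (x : {j : ι // j ≠ i} → QT ι P) : QT ι P

open Classical in
noncomputable def QT.tup {ι : Type} {P : Type u} (i : ι) (x : {j : ι // j ≠ i} → QT ι P) :
    ι → QT ι P :=
  fun j => if h : j = i then QT.node i x else x ⟨j, h⟩

theorem QT.tup_self {ι : Type} {P : Type u} (i : ι) (x : {j : ι // j ≠ i} → QT ι P) :
    QT.tup i x i = QT.node i x := by simp [QT.tup]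

theorem QT.tup_ne {ι : Type} {P : Type u} (i : ι) (x : {j : ι // j ≠ i} → QT ι P)
    (j : ι) (h : j ≠ i) : QT.tup i x j = x ⟨j, h⟩ := by simp [QT.tup, h]

/-- nodes newly added over a stage -/
def QT.New {ι : Type} {P : Type u} (s : Set (QT ι P) × Set (ι → QT ι P)) (i : ι)
    (x : {j : ι // j ≠ i} → QT ι P) : Prop :=
  (∀ j, x j ∈ s.1) ∧ ¬ ∃ y ∈ s.2, ∀ j (h : j ≠ i), y j = x ⟨j, h⟩

def QT.step {ι : Type} {P : Type u} (s : Set (QT ι P) × Set (ι → QT ι P)) :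
    Set (QT ι P) × Set (ι → QT ι P) :=
  (s.1 ∪ {t | ∃ i x, QT.New s i x ∧ t = QT.node i x},
   s.2 ∪ {t | ∃ i x, QT.New s i x ∧ t = QT.tup i x})

structure QT.Inv {ι : Type} {P : Type u} (s : Set (QT ι P) × Set (ι → QT ι P)) : Prop where
  mem : ∀ t ∈ s.2, ∀ i, t i ∈ s.1
  uniq : QUniq s.2
  node : ∀ i x, QT.node i x ∈ s.1 → QT.tup i x ∈ s.2

theorem QT.Inv.not_mem {ι : Type} {P : Type u} {s : Set (QT ι P) × Set (ι → QT ι P)}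
    (hs : QT.Inv s) {i : ι} {x : {j : ι // j ≠ i} → QT ι P} (h : QT.New s i x) :
    QT.node i x ∉ s.1 := fun hm =>
  h.2 ⟨_, hs.node i x hm, fun j hj => QT.tup_ne i x j hj⟩

theorem QT.Inv.old_new {ι : Type} {P : Type u} {s : Set (QT ι P) × Set (ι → QT ι P)}
    (hs : QT.Inv s) {i : ι} {x : {j : ι // j ≠ i} → QT ι P} (h : QT.New s i x)
    {y : ι → QT ι P} (hy : y ∈ s.2) (k : ι) (hk : ∀ j, j ≠ k → y j = QT.tup i x j) : False := by
  by_cases hik : i = k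
  · subst hik
    exact h.2 ⟨y, hy, fun j hj => by rw [hk j hj, QT.tup_ne i x j hj]⟩
  · have := hk i hik
    rw [QT.tup_self] at this
    exact hs.not_mem h (this ▸ hs.mem y hy i)

theorem QT.Inv.step {ι : Type} {P : Type u} {s : Set (QT ι P) × Set (ι → QT ι P)}
    (hs : QT.Inv s) : QT.Inv (QT.step s) := by
  refine ⟨?_, ?_, ?_⟩
  · rintro t (ht | ⟨i, x, h, rfl⟩) j
    · exact Or.inl (hs.mem t ht j)
    · by_cases hj : j = i
      · subst hj
        exact Or.inr ⟨j, x, h, QT.tup_self j x⟩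
      · left
        rw [QT.tup_ne i x j hj]
        exact h.1 _
  · rintro t (ht | ⟨i, x, h, rfl⟩) t' (ht' | ⟨i', x', h', rfl⟩) k hk
    · exact hs.uniq t ht t' ht' k hk
    · exact (hs.old_new h' ht k hk).elim
    · exact (hs.old_new h ht' k (fun j hj => (hk j hj).symm)).elim
    · by_cases hii : i = i'
      · subst hii
        have hxx : x = x' := by
          by_cases hik : i = k
          · subst hik
            funext ⟨j, hj⟩
            have := hk j hj
            rwa [QT.tup_ne i x j hj, QT.tup_ne i x' j hj] at this
          · have := hk i hik
            rw [QT.tup_self, QT.tup_self] at this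
            simpa using this
        rw [hxx]
      · exfalso
        by_cases hik : i = k
        · have hj : i' ≠ k := fun e => hii (hik.trans e.symm)
          have := hk i' hj
          rw [QT.tup_self, QT.tup_ne i x i' (Ne.symm hii)] at this
          exact hs.not_mem h' (this ▸ h.1 _)
        · have := hk i hik
          rw [QT.tup_self, QT.tup_ne i' x' i hii] at this
          exact hs.not_mem h (this ▸ h'.1 _)
  · rintro i x (h | ⟨i', x', h, e⟩)
    · exact Or.inl (hs.node i x h)
    · cases e
      exact Or.inr ⟨i, x, h, rfl⟩

theorem QT.embed {ι : Type} [Finite ι] {P : Type u} (R0 : Set (ι → P)) (h0 : QUniq R0) :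
    ∃ (D : Type u) (e : P → D) (R : Set (ι → D)), Function.Injective e ∧
      (∀ x ∈ R0, e ∘ x ∈ R) ∧ QUniq R ∧ QTotal R := by
  classical
  let s : ℕ → Set (QT ι P) × Set (ι → QT ι P) := fun k =>
    QT.step^[k] (Set.range QT.base, {t | ∃ x ∈ R0, t = QT.base ∘ x})
  have hs1 : ∀ k, s (k+1) = QT.step (s k) := fun k => Function.iterate_succ_apply' _ _ _
  have hinv : ∀ k, QT.Inv (s k) := by
    intro k
    induction k with
    | zero =>
      refine ⟨?_, ?_, ?_⟩
      · rintro t ⟨x, hx, rfl⟩ i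
        exact ⟨x i, rfl⟩
      · rintro t ⟨x, hx, rfl⟩ t' ⟨y, hy, rfl⟩ i h
        rw [h0 x hx y hy i (fun j hj => by simpa using h j hj)]
      · rintro i x ⟨p, hp⟩
        cases hp
    | succ k ih => rw [hs1]; exact ih.step
  have hm1 : Monotone (fun k => (s k).1) := monotone_nat_of_le_succ (fun k => by
    simp only [hs1]; exact Set.subset_union_left)
  have hm2 : Monotone (fun k => (s k).2) := monotone_nat_of_le_succ (fun k => by
    simp only [hs1]; exact Set.subset_union_left)
  refine ⟨{t : QT ι P // ∃ k, t ∈ (s k).1}, fun p => ⟨QT.base p, 0, p, rfl⟩,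
    {t | ∃ k, (fun i => (t i).1) ∈ (s k).2}, ?_, ?_, ?_, ?_⟩
  · intro p q h
    simpa using h
  · intro x hx
    exact ⟨0, x, hx, rfl⟩
  · rintro x ⟨k, hx⟩ y ⟨l, hy⟩ i h
    have := (hinv (max k l)).uniq _ (hm2 (le_max_left k l) hx) _ (hm2 (le_max_right k l) hy) i
      (fun j hj => congrArg Subtype.val (h j hj))
    funext j
    exact Subtype.ext (congrFun this j)
  · intro x i
    choose k hk using fun j => (x j).2
    obtain ⟨K, hK⟩ := (Set.finite_range k).bddAbove
    have hxK : ∀ j, (x j).1 ∈ (s K).1 := fun j => hm1 (hK ⟨j, rfl⟩) (hk j)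
    have key : ∃ l, ∃ y ∈ (s l).2, ∀ j, j ≠ i → y j = (x j).1 := by
      by_cases hy : ∃ y ∈ (s K).2, ∀ j, j ≠ i → y j = (x j).1
      · exact ⟨K, hy⟩
      · refine ⟨K+1, QT.tup i (fun j => (x j).1), ?_, fun j hj => QT.tup_ne _ _ j hj⟩
        rw [hs1]
        exact Or.inr ⟨i, _, ⟨fun j => hxK j, hy⟩, rfl⟩
    obtain ⟨l, y, hy, hyx⟩ := key
    exact ⟨fun j => ⟨y j, l, (hinv l).mem y hy j⟩, ⟨l, hy⟩, fun j hj => Subtype.ext (hyx j hj)⟩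

def QGraph {n : ℕ} {X : Type*} (f : (Fin n → X) → X) : Set (Option (Fin n) → X) :=
  {x | f (fun i => x (some i)) = x none}

theorem QGraph.uniq {n : ℕ} {X : Type*} (f : (Fin n → X) → X)
    (hf : ∀ (a : Fin n → X) (i : Fin n), ∃! b : X, f (Function.update a i b) = a i) :
    QUniq (QGraph f) := by
  intro x hx y hy i h
  have hx : f (fun i => x (some i)) = x none := hx
  have hy : f (fun i => y (some i)) = y none := hy
  cases i with
  | none =>
    have hs : ∀ k, x (some k) = y (some k) := fun k => h _ (by simp)
    funext j
    cases j with
    | none => rw [← hx, ← hy]; simp only [hs]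
    | some k => exact hs k
  | some i =>
    have hn : x none = y none := h _ (by simp)
    have hu := (hf (Function.update (fun k => x (some k)) i (x none)) i).unique
      (y₁ := x (some i)) (y₂ := y (some i))
      (by
        rw [Function.update_idem, Function.update_self, ← hx]
        congr 1
        exact Function.update_eq_self i _)
      (by
        rw [Function.update_idem, Function.update_self, hn, ← hy]
        congr 1
        funext k
        by_cases hk : k = i
        · subst hk; simp
        · rw [Function.update_of_ne hk]
          exact h _ (by simpa using hk))
    funext j
    by_cases hj : j = some i
    · rw [hj, hu]
    · exact h j hj

theorem QGraph.total {n : ℕ} {X : Type*} (f : (Fin n → X) → X)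
    (hf : ∀ (a : Fin n → X) (i : Fin n), ∃! b : X, f (Function.update a i b) = a i) :
    QTotal (QGraph f) := by
  intro x i
  cases i with
  | none =>
    refine ⟨fun j => j.elim (f fun k => x (some k)) (fun k => x (some k)), rfl, ?_⟩
    intro j hj
    cases j with
    | none => exact (hj rfl).elim
    | some k => rfl
  | some i =>
    obtain ⟨b, hb, -⟩ := hf (Function.update (fun k => x (some k)) i (x none)) i
    simp only [Function.update_idem, Function.update_self] at hb
    refine ⟨fun j => j.elim (x none) (Function.update (fun k => x (some k)) i b), hb, ?_⟩
    intro j hj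
    cases j with
    | none => rfl
    | some k =>
      have hk : k ≠ i := by simpa using hj
      show Function.update (fun k => x (some k)) i b k = x (some k)
      rw [Function.update_of_ne hk]

theorem QGraph.exists_op {n : ℕ} (hn : 1 ≤ n) {X : Type*} (R : Set (Option (Fin n) → X))
    (hu : QUniq R) (ht : QTotal R) : ∃ f : (Fin n → X) → X,
      (∀ (a : Fin n → X) (i : Fin n), ∃! b : X, f (Function.update a i b) = a i) ∧
      ∀ x ∈ R, f (fun i => x (some i)) = x none := by
  have h : ∀ a : Fin n → X, ∃ y ∈ R, ∀ k, y (some k) = a k := by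
    intro a
    obtain ⟨y, hy, h⟩ := ht (fun j => j.elim (a ⟨0, hn⟩) a) none
    exact ⟨y, hy, fun k => h (some k) (by simp)⟩
  choose g hgR hg using h
  have hR : ∀ x ∈ R, g (fun i => x (some i)) none = x none := by
    intro x hx
    refine congrFun (hu _ (hgR _) x hx none ?_) none
    intro j hj
    cases j with
    | none => exact (hj rfl).elim
    | some k => exact hg _ k
  refine ⟨fun a => g a none, ?_, hR⟩
  intro a i
  obtain ⟨y, hy, h⟩ := ht (fun j => j.elim (a i) a) (some i)
  have hyn : y none = a i := h none (by simp)
  refine ⟨y (some i), ?_, ?_⟩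
  · have e : Function.update a i (y (some i)) = fun k => y (some k) := by
      funext k
      by_cases hk : k = i
      · subst hk; simp
      · rw [Function.update_of_ne hk]
        exact (h (some k) (by simpa using hk)).symm
    show g (Function.update a i (y (some i))) none = a i
    rw [e, hR y hy, hyn]
  · intro b hb
    have e := hu _ (hgR (Function.update a i b)) y hy (some i) (by
      intro j hj
      cases j with
      | none => exact hb.trans hyn.symm
      | some k =>
        have hk : k ≠ i := by simpa using hj
        rw [hg, Function.update_of_ne hk]
        exact (h (some k) hj).symm)
    rw [← congrFun e (some i), hg, Function.update_self]


/-- The variety of n-quasigroups satisfies the strong amalgamation property. -/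
theorem stmt_4 (n : ℕ) (hn : 1 ≤ n) (A B C : Type u)
    (fA : (Fin n → A) → A) (fB : (Fin n → B) → B) (fC : (Fin n → C) → C)
    (hA : ∀ (a : Fin n → A) (i : Fin n), ∃! b : A, fA (Function.update a i b) = a i)
    (hB : ∀ (a : Fin n → B) (i : Fin n), ∃! b : B, fB (Function.update a i b) = a i)
    (hC : ∀ (a : Fin n → C) (i : Fin n), ∃! b : C, fC (Function.update a i b) = a i)
    (φ : A → B) (ψ : A → C)
    (hφi : Function.Injective φ) (hψi : Function.Injective ψ)
    (hφ : ∀ x : Fin n → A, φ (fA x) = fB (φ ∘ x))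
    (hψ : ∀ x : Fin n → A, ψ (fA x) = fC (ψ ∘ x)) :
    ∃ (D : Type u) (fD : (Fin n → D) → D) (β : B → D) (γ : C → D),
      (∀ (a : Fin n → D) (i : Fin n), ∃! b : D, fD (Function.update a i b) = a i) ∧
      Function.Injective β ∧ Function.Injective γ ∧
      (∀ x : Fin n → B, β (fB x) = fD (β ∘ x)) ∧
      (∀ x : Fin n → C, γ (fC x) = fD (γ ∘ x)) ∧
      β ∘ φ = γ ∘ ψ ∧
      (∀ (b : B) (c : C), β b = γ c → ∃ a : A, b = φ a ∧ c = ψ a) := by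
  classical
  -- the amalgam of the underlying sets
  obtain ⟨P, β, γ, hβ, hγ, hc, hst⟩ : ∃ (P : Type u) (β : B → P) (γ : C → P),
      Function.Injective β ∧ Function.Injective γ ∧ (∀ a, β (φ a) = γ (ψ a)) ∧
      (∀ (b : B) (c : C), β b = γ c → ∃ a : A, b = φ a ∧ c = ψ a) := by
    let γ : C → B ⊕ C := fun c => if h : ∃ a, ψ a = c then Sum.inl (φ h.choose) else Sum.inr c
    have h1 : ∀ a, γ (ψ a) = Sum.inl (φ a) := by
      intro a
      have h : ∃ a', ψ a' = ψ a := ⟨a, rfl⟩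
      have e : h.choose = a := hψi h.choose_spec
      simp only [γ, dif_pos h, e]
    have h2 : ∀ c, (¬ ∃ a, ψ a = c) → γ c = Sum.inr c := fun c h => by simp only [γ, dif_neg h]
    refine ⟨B ⊕ C, Sum.inl, γ, Sum.inl_injective, ?_, fun a => (h1 a).symm, ?_⟩
    · intro c c' h
      by_cases hc : ∃ a, ψ a = c <;> by_cases hc' : ∃ a, ψ a = c'
      · obtain ⟨a, rfl⟩ := hc
        obtain ⟨a', rfl⟩ := hc'
        rw [h1, h1] at h
        rw [hφi (Sum.inl_injective h)]
      · obtain ⟨a, rfl⟩ := hc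
        rw [h1, h2 _ hc'] at h
        cases h
      · obtain ⟨a', rfl⟩ := hc'
        rw [h1, h2 _ hc] at h
        cases h
      · rw [h2 _ hc, h2 _ hc'] at h
        exact Sum.inr_injective h
    · intro b c h
      by_cases hc : ∃ a, ψ a = c
      · obtain ⟨a, rfl⟩ := hc
        rw [h1] at h
        exact ⟨a, Sum.inl_injective h, rfl⟩
      · rw [h2 _ hc] at h
        cases h
  have cross : ∀ x ∈ QGraph fB, ∀ y ∈ QGraph fC, ∀ i,
      (∀ j, j ≠ i → β (x j) = γ (y j)) → β ∘ x = γ ∘ y := by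
    intro x hx y hy i h
    have h' : ∀ j, j ≠ i → ∃ a : A, x j = φ a ∧ y j = ψ a := fun j hj => hst _ _ (h j hj)
    have hne : ∃ j : Option (Fin n), j ≠ i := by
      cases i with
      | none => exact ⟨some ⟨0, hn⟩, by simp⟩
      | some k => exact ⟨none, by simp⟩
    obtain ⟨j0, hj0⟩ := hne
    obtain ⟨a0, -⟩ := h' j0 hj0
    have h'' : ∀ j, ∃ a : A, j ≠ i → x j = φ a ∧ y j = ψ a := by
      intro j
      by_cases hj : j = i
      · exact ⟨a0, fun e => (e hj).elim⟩
      · obtain ⟨a, ha⟩ := h' j hj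
        exact ⟨a, fun _ => ha⟩
    choose a ha using h''
    obtain ⟨t, ht, hta⟩ := QGraph.total fA hA a i
    have ht : fA (fun k => t (some k)) = t none := ht
    have e1 : x = φ ∘ t := QGraph.uniq fB hB x hx _
      (by show fB _ = φ (t none); rw [← ht, hφ]; rfl) i
      (fun j hj => by rw [(ha j hj).1, Function.comp_apply, hta j hj])
    have e2 : y = ψ ∘ t := QGraph.uniq fC hC y hy _
      (by show fC _ = ψ (t none); rw [← ht, hψ]; rfl) i
      (fun j hj => by rw [(ha j hj).2, Function.comp_apply, hta j hj])
    rw [e1, e2]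
    funext j
    exact hc _
  obtain ⟨D, e, R, he, heR, hu, ht⟩ := QT.embed
    ({t | ∃ x ∈ QGraph fB, t = β ∘ x} ∪ {t | ∃ x ∈ QGraph fC, t = γ ∘ x} :
      Set (Option (Fin n) → P)) (by
    rintro _ (⟨x, hx, rfl⟩ | ⟨x, hx, rfl⟩) _ (⟨y, hy, rfl⟩ | ⟨y, hy, rfl⟩) i h
    · rw [QGraph.uniq fB hB x hx y hy i (fun j hj => hβ (h j hj))]
    · exact cross x hx y hy i h
    · exact (cross y hy x hx i (fun j hj => (h j hj).symm)).symm
    · rw [QGraph.uniq fC hC x hx y hy i (fun j hj => hγ (h j hj))])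
  obtain ⟨f, hf, hfR⟩ := QGraph.exists_op hn R hu ht
  refine ⟨D, f, e ∘ β, e ∘ γ, hf, he.comp hβ, he.comp hγ, ?_, ?_, ?_, ?_⟩
  · intro x
    exact (hfR _ (heR _ (Or.inl ⟨fun j => j.elim (fB x) x, rfl, rfl⟩))).symm
  · intro x
    exact (hfR _ (heR _ (Or.inr ⟨fun j => j.elim (fC x) x, rfl, rfl⟩))).symm
  · funext a
    exact congrArg e (hc a)
  · intro b c h
    exact hst b c (he h)
end

section
/- The variety of n-loops satisfies the strong amalgamation property: let n ≥ 1, let A, B, C be n-loops, and let φ : A → B and ψ : A → C be injective homomorphisms. Then there exist an n-loop D and injective homomorphisms β : B → D and γ : C → D such that β ∘ φ = γ ∘ ψ and, for all b : B and c : C, if β b = γ c then there exists a : A with b = φ a and c = ψ a. -/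
universe u

inductive NTm (n : ℕ) (P : Type u) : Type u
  | base : P → NTm n P
  | sol : Option (Fin n) → (Option (Fin n) → NTm n P) → NTm n P

def NUnit {n : ℕ} {T : Type u} (e : T) (j : Fin n) (x : T) : Option (Fin n) → T
  | none => x
  | some k => if k = j then x else e

def NLatin {n : ℕ} {T : Type u} (R : Set (Option (Fin n) → T)) : Prop :=
  ∀ s ∈ R, ∀ t ∈ R, ∀ i, (∀ k, k ≠ i → s k = t k) → s = t

structure NGood {n : ℕ} {P : Type u} (e : P) (R : Set (Option (Fin n) → NTm n P)) : Prop where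
  latin : NLatin R
  unit : ∀ t ∈ R, ∀ i j, NUnit (.base e) j (t i) ∈ R
  eocc : ∃ t ∈ R, ∃ i, t i = .base e
  fresh : ∀ t ∈ R, ∀ k i s, t k = .sol i s → Function.update s i (.sol i s) ∈ R

theorem NGood.step {n : ℕ} {P : Type u} {e : P} {R : Set (Option (Fin n) → NTm n P)}
    (h : NGood e R) (t : Option (Fin n) → NTm n P) (i : Option (Fin n))
    (ht : ∀ k, k ≠ i → ∃ s ∈ R, ∃ l, s l = t k)
    (hne : ∀ b, Function.update t i b ∉ R) :
    NGood e (R ∪ ({Function.update t i (.sol i t)} ∪ Set.range (fun j => NUnit (.base e) j (.sol i t)))) := by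
  have hd : ∀ s ∈ R, ∀ k, s k ≠ .sol i t := fun s hs k hk => hne _ (h.fresh s hs k i t hk)
  have htd : ∀ k, k ≠ i → t k ≠ .sol i t := by
    intro k hk
    obtain ⟨s, hs, l, hl⟩ := ht k hk
    rw [← hl]; exact hd s hs l
  have htu : ∀ k, k ≠ i → ∀ j, NUnit (.base e) j (t k) ∈ R := by
    intro k hk
    obtain ⟨s, hs, l, hl⟩ := ht k hk
    rw [← hl]; exact h.unit s hs l
  have htf : ∀ k, k ≠ i → ∀ i' s', t k = .sol i' s' → Function.update s' i' (.sol i' s') ∈ R := by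
    intro k hk
    obtain ⟨s, hs, l, hl⟩ := ht k hk
    rw [← hl]; exact h.fresh s hs l
  have heu : ∀ j, NUnit (.base e) j (.base e) ∈ R := by
    obtain ⟨s, hs, l, hl⟩ := h.eocc
    have := h.unit s hs l
    rwa [hl] at this
  have hed : (NTm.base e : NTm n P) ≠ .sol i t := by simp
  generalize hdd : (NTm.sol i t : NTm n P) = d at *
  -- the three mixed latin cases
  have L1 : ∀ s ∈ R, ∀ k, (∀ m, m ≠ k → s m = Function.update t i d m) → False := by
    intro s hs k hk
    have : k = i := by
      by_contra hki
      have := hk i (Ne.symm hki)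
      simp at this
      exact hd s hs i this
    subst this
    apply hne (s k)
    convert hs using 1
    funext m
    by_cases hm : m = k
    · subst hm; simp
    · have := hk m hm
      simp [hm] at this ⊢
      exact this.symm
  have L2 : ∀ s ∈ R, ∀ j k, (∀ m, m ≠ k → s m = NUnit (.base e) j d m) → False := by
    intro s hs j k hk
    by_cases hkn : k = none
    · exact hd s hs (some j) (by rw [hk (some j) (by simp [hkn])]; simp [NUnit])
    · exact hd s hs none (by rw [hk none (Ne.symm hkn)]; simp [NUnit])
  have L3 : ∀ j k, (∀ m, m ≠ k → Function.update t i d m = NUnit (.base e) j d m) → False := by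
    intro j k hk
    have h1 : none ≠ k → none = i := by
      intro h1
      by_contra h2
      have := hk none h1
      simp [h2, NUnit] at this
      exact htd _ h2 this
    have h2 : some j ≠ k → some j = i := by
      intro h1
      by_contra h2
      have := hk _ h1
      simp [h2, NUnit] at this
      exact htd _ h2 this
    have hki : k ≠ i := by
      rintro rfl
      by_cases hkn : none = k
      · subst hkn; simp at h2
      · exact hkn (h1 hkn)
    apply hne (t k)
    convert htu k hki j using 1
    funext m
    have key : (i = none ∧ k = some j) ∨ (i = some j ∧ k = none) := by
      by_cases hkn : none = k
      · right; subst hkn; exact ⟨(h2 (by simp)).symm, rfl⟩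
      · left
        have := h1 hkn
        subst this
        refine ⟨rfl, ?_⟩
        by_contra h3
        simpa using h2 (Ne.symm h3)
    by_cases hmk : m = k
    · subst hmk
      rw [Function.update_of_ne hki]
      rcases key with ⟨_, rfl⟩ | ⟨_, rfl⟩ <;> simp [NUnit]
    · by_cases hmi : m = i
      · subst hmi
        rcases key with ⟨rfl, _⟩ | ⟨rfl, _⟩ <;> simp [NUnit]
      · have := hk m hmk
        rw [Function.update_of_ne hmi] at this ⊢
        rw [this]
        cases m with
        | none => rcases key with ⟨rfl, rfl⟩ | ⟨rfl, rfl⟩ <;> simp at hmk hmi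
        | some m =>
          have : m ≠ j := by
            rintro rfl
            rcases key with ⟨rfl, rfl⟩ | ⟨rfl, rfl⟩ <;> simp at hmk hmi
          simp [NUnit, this]
  have L4 : ∀ (j j' : Fin n) (k : Option (Fin n)), (∀ m : Option (Fin n), m ≠ k → NUnit (.base e) j d m = NUnit (.base e) j' d m) → j = j' := by
    intro j j' k hk
    by_contra hjj
    by_cases hkj : some j = k
    · have := hk (some j') (by rw [← hkj]; simpa using Ne.symm hjj)
      simp [NUnit, Ne.symm hjj] at this
      exact hed this
    · have := hk (some j) hkj
      simp [NUnit, hjj] at this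
      exact hed this.symm
  refine ⟨?_, ?_, ?_, ?_⟩
  · rintro s (hs | rfl | ⟨j, rfl⟩) s' (hs' | rfl | ⟨j', rfl⟩) k hk
    · exact h.latin s hs s' hs' k hk
    · exact (L1 s hs k hk).elim
    · exact (L2 s hs j' k hk).elim
    · exact (L1 s' hs' k (fun m hm => (hk m hm).symm)).elim
    · rfl
    · exact (L3 j' k hk).elim
    · exact (L2 s' hs' j k (fun m hm => (hk m hm).symm)).elim
    · exact (L3 j k (fun m hm => (hk m hm).symm)).elim
    · rw [L4 j j' k hk]
  · rintro s (hs | rfl | ⟨j, rfl⟩) k j'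
    · exact Or.inl (h.unit s hs k j')
    · by_cases hk : k = i
      · subst hk
        right; right; exact ⟨j', by simp⟩
      · left
        rw [Function.update_of_ne hk]
        exact htu k hk j'
    · have : NUnit (.base e) j d k = d ∨ NUnit (.base e) j d k = .base e := by
        cases k with
        | none => simp [NUnit]
        | some k => by_cases hkj : k = j <;> simp [NUnit, hkj]
      rcases this with h1 | h1
      · right; right; exact ⟨j', by simp [h1]⟩
      · left; simp only [h1]; exact heu j'
  · obtain ⟨s, hs, l⟩ := h.eocc
    exact ⟨s, Or.inl hs, l⟩
  · have hdf : ∀ i' s', d = .sol i' s' → Function.update s' i' (.sol i' s') ∈ R ∪ ({Function.update t i d} ∪ Set.range (fun j => NUnit (.base e) j d)) := by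
      intro i' s' hh
      have h2 := hdd.trans hh
      rw [NTm.sol.injEq] at h2
      obtain ⟨rfl, rfl⟩ := h2
      right; left; rw [hdd]; rfl
    rintro s (hs | rfl | ⟨j, rfl⟩) k i' s' hk'
    · exact Or.inl (h.fresh s hs k i' s' hk')
    · by_cases hk : k = i
      · subst hk
        exact hdf i' s' (by simpa using hk')
      · rw [Function.update_of_ne hk] at hk'
        exact Or.inl (htf k hk i' s' hk')
    · have : NUnit (.base e) j d k = d ∨ NUnit (.base e) j d k = .base e := by
        cases k with
        | none => simp [NUnit]
        | some k => by_cases hkj : k = j <;> simp [NUnit, hkj]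
      rcases this with h1 | h1
      · exact hdf i' s' (by rw [← h1]; exact hk')
      · simp [h1] at hk'

theorem NGood.exists_complete {n : ℕ} {P : Type u} {e : P} {R₀ : Set (Option (Fin n) → NTm n P)}
    (h : NGood e R₀) : ∃ R, R₀ ⊆ R ∧ NGood e R ∧ ∀ (t : Option (Fin n) → NTm n P) (i : Option (Fin n)),
      (∀ k, k ≠ i → ∃ s ∈ R, ∃ l, s l = t k) → ∃ b, Function.update t i b ∈ R := by
  obtain ⟨R, hsub, hmax⟩ := zorn_subset_nonempty {R | NGood e R} (by
    intro c hc hch hcn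
    refine ⟨⋃₀ c, ⟨?_, ?_, ?_, ?_⟩, fun s hs => Set.subset_sUnion_of_mem hs⟩
    · rintro s ⟨S, hS, hs⟩ t ⟨S', hS', ht⟩
      rcases hch.total hS hS' with h1 | h1
      · exact (hc hS').latin s (h1 hs) t ht
      · exact (hc hS).latin s hs t (h1 ht)
    · rintro s ⟨S, hS, hs⟩ i j
      exact ⟨S, hS, (hc hS).unit s hs i j⟩
    · obtain ⟨S, hS⟩ := hcn
      obtain ⟨t, ht, h1⟩ := (hc hS).eocc
      exact ⟨t, ⟨S, hS, ht⟩, h1⟩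
    · rintro s ⟨S, hS, hs⟩ k i s' hk
      exact ⟨S, hS, (hc hS).fresh s hs k i s' hk⟩) R₀ h
  refine ⟨R, hsub, hmax.prop, fun t i ht => ?_⟩
  by_contra hne
  push Not at hne
  have hg := NGood.step hmax.prop t i ht hne
  have := hmax.le_of_ge hg Set.subset_union_left
  exact hne _ (this (Or.inr (Or.inl rfl)))

theorem NLoop.completion {n : ℕ} {P : Type u} (e : P) (R₀ : Set (Option (Fin n) → P))
    (hl : NLatin R₀) (hu : ∀ t ∈ R₀, ∀ i j, NUnit e j (t i) ∈ R₀)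
    (he : ∃ t ∈ R₀, ∃ i, t i = e) :
    ∃ (D : Type u) (fD : (Fin n → D) → D) (eD : D) (ι : P → D),
      (∀ (a : Fin n → D) (i : Fin n), ∃! b : D, fD (Function.update a i b) = a i) ∧
      (∀ (i : Fin n) (x : D), fD (Function.update (fun _ => eD) i x) = x) ∧
      ι e = eD ∧ (∀ t ∈ R₀, fD (fun k => ι (t (some k))) = ι (t none)) ∧
      (∀ s ∈ R₀, ∀ t ∈ R₀, ∀ i j, ι (s i) = ι (t j) → s i = t j) := by
  classical
  have hg : NGood e ((fun t : Option (Fin n) → P => fun k => (NTm.base (t k) : NTm n P)) '' R₀) := by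
    refine ⟨?_, ?_, ?_, ?_⟩
    · rintro _ ⟨s, hs, rfl⟩ _ ⟨t, ht, rfl⟩ i hk
      rw [hl s hs t ht i (fun k hki => by simpa using hk k hki)]
    · rintro _ ⟨s, hs, rfl⟩ i j
      refine ⟨_, hu s hs i j, ?_⟩
      funext k
      cases k with
      | none => rfl
      | some k => by_cases hkj : k = j <;> simp [NUnit, hkj]
    · obtain ⟨t, ht, i, hi⟩ := he
      exact ⟨_, ⟨t, ht, rfl⟩, i, by simp [hi]⟩
    · rintro _ ⟨s, hs, rfl⟩ k i s' hk
      simp at hk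
  obtain ⟨R, hsub, hR, hext⟩ := hg.exists_complete
  let D := {x : NTm n P // ∃ s ∈ R, ∃ l, s l = x}
  have hex : ∀ a : Fin n → D, ∃ d : D, (fun k : Option (Fin n) => k.elim d.1 (fun m => (a m).1)) ∈ R := by
    intro a
    obtain ⟨b, hb⟩ := hext (fun k => k.elim (.base e) (fun m => (a m).1)) none (by
      intro k hk
      cases k with
      | none => simp at hk
      | some k => exact (a k).2)
    refine ⟨⟨b, _, hb, none, by simp⟩, ?_⟩
    convert hb using 1
    funext k
    cases k <;> simp
  choose f hf using hex
  have hfu : ∀ (a : Fin n → D) (d : D),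
      (fun k : Option (Fin n) => k.elim d.1 (fun m => (a m).1)) ∈ R → f a = d := by
    intro a d hd
    have := hR.latin _ (hf a) _ hd none (by
      intro k hk
      cases k with
      | none => simp at hk
      | some k => rfl)
    exact Subtype.ext (congrFun this none)
  let eD : D := ⟨.base e, hR.eocc⟩
  let ι : P → D := fun p => if hp : ∃ s ∈ R, ∃ l, s l = .base p then ⟨.base p, hp⟩ else eD
  have hι : ∀ t ∈ R₀, ∀ i, (ι (t i)).1 = .base (t i) := by
    intro t ht i
    have : ∃ s ∈ R, ∃ l, s l = .base (t i) := ⟨_, hsub ⟨t, ht, rfl⟩, i, rfl⟩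
    simp only [ι, dif_pos this]
  refine ⟨D, f, eD, ι, ?_, ?_, ?_, ?_, ?_⟩
  · intro a i
    obtain ⟨b, hb⟩ := hext (fun k => k.elim (a i).1 (fun m => (a m).1)) (some i) (by
      intro k hk
      cases k with
      | none => exact (a i).2
      | some k => exact (a k).2)
    refine ⟨⟨b, _, hb, some i, by simp⟩, ?_, ?_⟩
    · apply hfu
      convert hb using 1
      funext k
      cases k with
      | none => simp
      | some k =>
        by_cases hk : k = i
        · subst hk; simp
        · simp [hk]
    · intro c hc
      have h1 := hf (Function.update a i c)
      rw [hc] at h1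
      have := hR.latin _ h1 _ hb (some i) (by
        intro k hk
        cases k with
        | none => simp
        | some k =>
          have hk : k ≠ i := by simpa using hk
          simp [hk])
      apply Subtype.ext
      simpa using congrFun this (some i)
  · intro i x
    apply hfu
    obtain ⟨s, hs, l, hl⟩ := x.2
    have := hR.unit s hs l i
    rw [hl] at this
    convert this using 1
    funext k
    cases k with
    | none => rfl
    | some k =>
      by_cases hk : k = i
      · subst hk; simp [NUnit]
      · simp [hk, NUnit, eD]
  · have : ∃ s ∈ R, ∃ l, s l = .base e := hR.eocc
    simp only [ι, dif_pos this, eD]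
  · intro t ht
    apply hfu
    convert hsub ⟨t, ht, rfl⟩ using 1
    funext k
    cases k with
    | none => exact hι t ht _
    | some k => exact hι t ht _
  · intro s hs t ht i j hij
    have := congrArg Subtype.val hij
    rw [hι s hs, hι t ht] at this
    simpa using this

def NGr {n : ℕ} {T : Type u} (f : (Fin n → T) → T) : Set (Option (Fin n) → T) :=
  {t | f (fun k => t (some k)) = t none}

theorem NGr.ext {n : ℕ} {T : Type u} (f : (Fin n → T) → T)
    (hT : ∀ (a : Fin n → T) (i : Fin n), ∃! b : T, f (Function.update a i b) = a i)
    (t : Option (Fin n) → T) (i : Option (Fin n)) : ∃ b, Function.update t i b ∈ NGr f := by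
  cases i with
  | none => exact ⟨f (fun k => t (some k)), by simp [NGr]⟩
  | some i =>
    obtain ⟨b, hb, -⟩ := hT (Function.update (fun k => t (some k)) i (t none)) i
    refine ⟨b, ?_⟩
    simp at hb
    simp only [NGr, Set.mem_ofPred_eq]
    rw [Function.update_of_ne (by simp), ← hb]
    congr 1
    funext k
    by_cases hk : k = i
    · subst hk; simp
    · simp [hk]

theorem NGr.latin {n : ℕ} {T : Type u} (f : (Fin n → T) → T)
    (hT : ∀ (a : Fin n → T) (i : Fin n), ∃! b : T, f (Function.update a i b) = a i) :
    NLatin (NGr f) := by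
  intro s hs t ht i h
  simp only [NGr, Set.mem_ofPred_eq] at hs ht
  cases i with
  | none =>
    have : (fun k => s (some k)) = fun k => t (some k) := funext fun k => h _ (by simp)
    funext k
    cases k with
    | none => rw [← hs, ← ht, this]
    | some k => exact h _ (by simp)
  | some i =>
    have h0 : s none = t none := h _ (by simp)
    have e1 : ∀ x : T, Function.update (Function.update (fun k => s (some k)) i (s none)) i x
        = Function.update (fun k => s (some k)) i x := by intro x; simp
    have := (hT (Function.update (fun k => s (some k)) i (s none)) i).unique
      (y₁ := s (some i)) (y₂ := t (some i)) (by
        rw [e1, Function.update_self, ← hs]; congr 1; funext k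
        by_cases hk : k = i
        · subst hk; simp
        · simp [hk]) (by
        rw [e1, Function.update_self, h0, ← ht]; congr 1; funext k
        by_cases hk : k = i
        · subst hk; simp
        · simp [hk, h (some k) (by simpa using hk)])
    funext k
    by_cases hk : k = some i
    · rw [hk, this]
    · exact h k hk

theorem NGr.unit {n : ℕ} {T : Type u} (f : (Fin n → T) → T) (e : T)
    (he : ∀ (i : Fin n) (x : T), f (Function.update (fun _ => e) i x) = x) (j : Fin n) (x : T) :
    NUnit e j x ∈ NGr f := by
  simp only [NGr, Set.mem_ofPred_eq, NUnit]
  refine Eq.trans ?_ (he j x)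
  congr 1
  funext k
  by_cases hk : k = j
  · subst hk; simp
  · simp [hk]

theorem NUnit.comp {n : ℕ} {S T : Type u} (g : S → T) (e : S) (j : Fin n) (x : S) :
    g ∘ NUnit e j x = NUnit (g e) j (g x) := by
  funext k
  cases k with
  | none => rfl
  | some k => by_cases hkj : k = j <;> simp [NUnit, hkj]

/-- The variety of n-loops satisfies the strong amalgamation property. -/
theorem stmt_5 (n : ℕ) (hn : 1 ≤ n) (A B C : Type u)
    (fA : (Fin n → A) → A) (fB : (Fin n → B) → B) (fC : (Fin n → C) → C)
    (eA : A) (eB : B) (eC : C)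
    (hA : ∀ (a : Fin n → A) (i : Fin n), ∃! b : A, fA (Function.update a i b) = a i)
    (hB : ∀ (a : Fin n → B) (i : Fin n), ∃! b : B, fB (Function.update a i b) = a i)
    (hC : ∀ (a : Fin n → C) (i : Fin n), ∃! b : C, fC (Function.update a i b) = a i)
    (heA : ∀ (i : Fin n) (x : A), fA (Function.update (fun _ => eA) i x) = x)
    (heB : ∀ (i : Fin n) (x : B), fB (Function.update (fun _ => eB) i x) = x)
    (heC : ∀ (i : Fin n) (x : C), fC (Function.update (fun _ => eC) i x) = x)
    (φ : A → B) (ψ : A → C)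
    (hφi : Function.Injective φ) (hψi : Function.Injective ψ)
    (hφ : ∀ x : Fin n → A, φ (fA x) = fB (φ ∘ x)) (hφe : φ eA = eB)
    (hψ : ∀ x : Fin n → A, ψ (fA x) = fC (ψ ∘ x)) (hψe : ψ eA = eC) :
    ∃ (D : Type u) (fD : (Fin n → D) → D) (eD : D) (β : B → D) (γ : C → D),
      (∀ (a : Fin n → D) (i : Fin n), ∃! b : D, fD (Function.update a i b) = a i) ∧
      (∀ (i : Fin n) (x : D), fD (Function.update (fun _ => eD) i x) = x) ∧
      Function.Injective β ∧ Function.Injective γ ∧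
      (∀ x : Fin n → B, β (fB x) = fD (β ∘ x)) ∧ β eB = eD ∧
      (∀ x : Fin n → C, γ (fC x) = fD (γ ∘ x)) ∧ γ eC = eD ∧
      β ∘ φ = γ ∘ ψ ∧
      (∀ (b : B) (c : C), β b = γ c → ∃ a : A, b = φ a ∧ c = ψ a) := by
  classical
  let g : C → B ⊕ C := fun c => if h : ∃ a, ψ a = c then Sum.inl (φ h.choose) else Sum.inr c
  have g1 : ∀ a, g (ψ a) = Sum.inl (φ a) := by
    intro a
    have h : ∃ a', ψ a' = ψ a := ⟨a, rfl⟩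
    simp only [g, dif_pos h]
    rw [hψi h.choose_spec]
  have g2 : ∀ b c, Sum.inl b = g c → ∃ a, b = φ a ∧ c = ψ a := by
    intro b c hbc
    by_cases h : ∃ a, ψ a = c
    · obtain ⟨a, rfl⟩ := h
      rw [g1] at hbc
      exact ⟨a, Sum.inl.inj hbc, rfl⟩
    · simp [g, dif_neg h] at hbc
  have g3 : Function.Injective g := by
    intro c c' hcc
    by_cases h : ∃ a, ψ a = c
    · obtain ⟨a, rfl⟩ := h
      rw [g1] at hcc
      obtain ⟨a', h1, rfl⟩ := g2 _ _ hcc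
      rw [hφi h1]
    · by_cases h' : ∃ a, ψ a = c'
      · obtain ⟨a, rfl⟩ := h'
        rw [g1] at hcc
        obtain ⟨a', h1, rfl⟩ := g2 _ _ hcc.symm
        rw [hφi h1]
      · simpa [g, dif_neg h, dif_neg h'] using hcc
  have ge : g eC = Sum.inl eB := by rw [← hψe, g1, hφe]
  have mixed : ∀ b ∈ NGr fB, ∀ c ∈ NGr fC, ∀ k, (∀ m, m ≠ k → (Sum.inl (b m) : B ⊕ C) = g (c m)) →
      (Sum.inl ∘ b : _ → B ⊕ C) = g ∘ c := by
    intro b hb c hc k hk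
    have : ∀ m, ∃ a, m ≠ k → b m = φ a ∧ c m = ψ a := by
      intro m
      by_cases hm : m = k
      · exact ⟨eA, fun h => (h hm).elim⟩
      · obtain ⟨a, ha⟩ := g2 _ _ (hk m hm)
        exact ⟨a, fun _ => ha⟩
    choose a ha using this
    obtain ⟨x, hx⟩ := NGr.ext fA hA a k
    have hb' : φ ∘ Function.update a k x ∈ NGr fB := by
      have := congrArg φ hx
      rw [hφ] at this
      exact this
    have hc' : ψ ∘ Function.update a k x ∈ NGr fC := by
      have := congrArg ψ hx
      rw [hψ] at this
      exact this
    rw [NGr.latin fB hB b hb _ hb' k (fun m hm => by simp [hm, (ha m hm).1]),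
      NGr.latin fC hC c hc _ hc' k (fun m hm => by simp [hm, (ha m hm).2])]
    funext m
    simp [g1]
  let i0 : Fin n := ⟨0, hn⟩
  let R₀ : Set (Option (Fin n) → B ⊕ C) := ((fun t => Sum.inl ∘ t) '' NGr fB) ∪ ((fun t => g ∘ t) '' NGr fC)
  have mB : ∀ t ∈ NGr fB, Sum.inl ∘ t ∈ R₀ := fun t ht => Or.inl ⟨t, ht, rfl⟩
  have mC : ∀ t ∈ NGr fC, g ∘ t ∈ R₀ := fun t ht => Or.inr ⟨t, ht, rfl⟩
  obtain ⟨D, fD, eD, ι, h1, h2, h3, h4, h5⟩ := NLoop.completion (Sum.inl eB : B ⊕ C) R₀ (by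
      rintro _ (⟨s, hs, rfl⟩ | ⟨s, hs, rfl⟩) _ (⟨t, ht, rfl⟩ | ⟨t, ht, rfl⟩) k hk
      · rw [NGr.latin fB hB s hs t ht k (fun m hm => Sum.inl.inj (hk m hm))]
      · exact mixed s hs t ht k hk
      · exact (mixed t ht s hs k (fun m hm => (hk m hm).symm)).symm
      · rw [NGr.latin fC hC s hs t ht k (fun m hm => g3 (hk m hm))])
    (by
      rintro _ (⟨s, hs, rfl⟩ | ⟨s, hs, rfl⟩) k j
      · have := mB _ (NGr.unit fB eB heB j (s k))
        rwa [NUnit.comp] at this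
      · have := mC _ (NGr.unit fC eC heC j (s k))
        rwa [NUnit.comp, ge] at this)
    ⟨_, mB _ (NGr.unit fB eB heB i0 eB), none, rfl⟩
  have uB := fun b => mB _ (NGr.unit fB eB heB i0 b)
  have uC := fun c => mC _ (NGr.unit fC eC heC i0 c)
  refine ⟨D, fD, eD, fun b => ι (Sum.inl b), fun c => ι (g c), h1, h2, ?_, ?_, ?_, h3, ?_, ?_, ?_, ?_⟩
  · intro b b' h
    exact Sum.inl.inj (h5 _ (uB b) _ (uB b') none none h)
  · intro c c' h
    exact g3 (h5 _ (uC c) _ (uC c') none none h)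
  · intro x
    exact (h4 _ (mB (fun k => k.elim (fB x) x) rfl)).symm
  · intro x
    exact (h4 _ (mC (fun k => k.elim (fC x) x) rfl)).symm
  · simp only [ge, h3]
  · funext a
    simp [g1]
  · intro b c h
    exact g2 _ _ (h5 _ (uB b) _ (uC c) none none h)
end

section
/- Every injective homomorphism of n-quasigroups is a regular monomorphism, concretely: let n ≥ 1, let B and C be n-quasigroups and let m : B → C be an injective homomorphism. Then there exist an n-quasigroup D and homomorphisms u, v : C → D such that u ∘ m = v ∘ m and, for every c : C, u c = v c if and only if c lies in the range of m. -/
universe u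

open Classical in
theorem exists_coeff {n : ℕ} (S : Finset (Fin n)) (e : ℚ) (he : e = 0 ∨ e = 1)
    (h1 : S = ∅ → e = 0) (h2 : ∀ j, S = {j} → e ≠ 0) :
    ∃ k : Fin n → ℚ, (∀ i, k i ≠ 0) ∧ ∑ i ∈ S, k i = e := by
  rcases S.eq_empty_or_nonempty with rfl | hS
  · exact ⟨fun _ => 1, by simp, by simp [h1 rfl]⟩
  have hc : (S.card : ℚ) ≠ 0 := by
    have := hS.card_pos
    positivity
  rcases he with rfl | rfl
  · obtain ⟨j, hj⟩ := hS
    have hne : (S.erase j).card ≠ 0 := by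
      intro h0
      rw [Finset.card_eq_zero] at h0
      apply h2 j _ rfl
      rw [← Finset.insert_erase hj, h0]
      rfl
    refine ⟨fun i => if i = j then -((S.erase j).card : ℚ) else 1, ?_, ?_⟩
    · intro i
      dsimp only
      split_ifs
      · exact neg_ne_zero.mpr (by exact_mod_cast hne)
      · exact one_ne_zero
    · rw [← Finset.add_sum_erase _ _ hj]
      rw [Finset.sum_congr rfl (g := fun _ => (1:ℚ))]
      · simp
      · intro x hx
        simp [Finset.ne_of_mem_erase hx]
  · refine ⟨fun _ => (S.card : ℚ)⁻¹, fun _ => inv_ne_zero hc, ?_⟩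
    simp [hc]

theorem sum_upd {n : ℕ} (k s : Fin n → ℚ) (i : Fin n) (t : ℚ) :
    ∑ j, k j * Function.update s i t j = k i * t + ∑ j ∈ Finset.univ.erase i, k j * s j := by
  rw [← Finset.add_sum_erase _ _ (Finset.mem_univ i)]
  congr 1
  · simp
  · apply Finset.sum_congr rfl
    intro x hx
    rw [Function.update_of_ne (Finset.ne_of_mem_erase hx)]

/-- Every injective homomorphism of n-quasigroups is a regular monomorphism. -/
theorem stmt_6 (n : ℕ) (hn : 1 ≤ n) (B C : Type u)
    (fB : (Fin n → B) → B) (fC : (Fin n → C) → C)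
    (hB : ∀ (a : Fin n → B) (i : Fin n), ∃! b : B, fB (Function.update a i b) = a i)
    (hC : ∀ (a : Fin n → C) (i : Fin n), ∃! b : C, fC (Function.update a i b) = a i)
    (m : B → C) (hmi : Function.Injective m)
    (hm : ∀ x : Fin n → B, m (fB x) = fC (m ∘ x)) :
    ∃ (D : Type u) (fD : (Fin n → D) → D) (u v : C → D),
      (∀ (a : Fin n → D) (i : Fin n), ∃! b : D, fD (Function.update a i b) = a i) ∧
      (∀ x : Fin n → C, u (fC x) = fD (u ∘ x)) ∧
      (∀ x : Fin n → C, v (fC x) = fD (v ∘ x)) ∧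
      u ∘ m = v ∘ m ∧
      (∀ c : C, u c = v c ↔ c ∈ Set.range m) := by
  classical
  let χ : C → ℚ := fun c => if c ∈ Set.range m then 0 else 1
  have hk : ∀ x : Fin n → C, ∃ k : Fin n → ℚ, (∀ i, k i ≠ 0) ∧
      ∑ i, k i * χ (x i) = χ (fC x) := by
    intro x
    have g1 : (Finset.univ.filter fun i => x i ∉ Set.range m) = ∅ → χ (fC x) = 0 := by
      intro h
      have h' : ∀ i, ∃ b, m b = x i := by
        intro i
        by_contra hi
        have : i ∈ (Finset.univ.filter fun i => x i ∉ Set.range m) := by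
          simpa using hi
        rw [h] at this
        simp at this
      choose y hy using h'
      have : fC x ∈ Set.range m := ⟨fB y, by rw [hm]; congr 1; funext i; exact hy i⟩
      simp only [χ, if_pos this]
    have g2 : ∀ j, (Finset.univ.filter fun i => x i ∉ Set.range m) = {j} → χ (fC x) ≠ 0 := by
      intro j h h0
      have hmem : ∀ i, x i ∉ Set.range m ↔ i = j := by
        intro i
        have : i ∈ (Finset.univ.filter fun i => x i ∉ Set.range m) ↔ i = j := by
          rw [h]; simp
        simpa using this
      have hf : fC x ∈ Set.range m := by
        by_contra hf
        simp only [χ, if_neg hf] at h0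
        exact one_ne_zero h0
      have h' : ∀ i, ∃ b, m b = Function.update x j (fC x) i := by
        intro i
        by_cases hi : i = j
        · subst hi
          simpa using hf
        · rw [Function.update_of_ne hi]
          by_contra hc
          exact hi ((hmem i).1 hc)
      choose y hy using h'
      obtain ⟨b, hb, -⟩ := hB y j
      have e1 : m ∘ Function.update y j b = Function.update x j (m b) := by
        funext i
        by_cases hi : i = j
        · subst hi; simp
        · simp only [Function.comp, Function.update_of_ne hi, hy]
      have e2 : fC (Function.update x j (m b)) = fC x := by
        rw [← e1, ← hm, hb, hy]; simp
      have := (hC (Function.update x j (fC x)) j).unique (y₁ := m b) (y₂ := x j)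
        (by simpa using e2) (by simp)
      exact (hmem j).2 rfl ⟨b, this⟩
    obtain ⟨k, hk0, hk⟩ := exists_coeff (Finset.univ.filter fun i => x i ∉ Set.range m)
      (χ (fC x)) (by dsimp only [χ]; split_ifs <;> simp) g1 g2
    · refine ⟨k, hk0, ?_⟩
      rw [← hk, Finset.sum_filter]
      apply Finset.sum_congr rfl
      intro i _
      dsimp only [χ]
      by_cases hi : x i ∈ Set.range m
      · rw [if_pos hi, if_neg (not_not.mpr hi), mul_zero]
      · rw [if_neg hi, if_pos hi, mul_one]
  choose k hk0 hk using hk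
  refine ⟨C × ℚ, fun x => (fC (fun i => (x i).1), ∑ i, k (fun i => (x i).1) i * (x i).2),
    fun c => (c, 0), fun c => (c, χ c), ?_, ?_, ?_, ?_, ?_⟩
  · intro a i
    have e1 : ∀ b : C × ℚ, (fun j => (Function.update a i b j).1)
        = Function.update (fun j => (a j).1) i b.1 := by
      intro b; funext j
      by_cases hj : j = i
      · subst hj; simp
      · simp [Function.update_of_ne hj]
    have e2 : ∀ (b : C × ℚ) j, (Function.update a i b j).2
        = Function.update (fun j => (a j).2) i b.2 j := by
      intro b j
      by_cases hj : j = i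
      · subst hj; simp
      · simp [Function.update_of_ne hj]
    simp only [e1, e2, sum_upd, Prod.ext_iff]
    obtain ⟨c, hc, hcu⟩ := hC (fun j => (a j).1) i
    set K := k (Function.update (fun j => (a j).1) i c) with hK
    have hKi : K i ≠ 0 := hk0 _ i
    refine ⟨(c, ((a i).2 - ∑ j ∈ Finset.univ.erase i, K j * (a j).2) / K i), ⟨hc, ?_⟩, ?_⟩
    · simp only [← hK]
      field_simp
      ring
    · rintro ⟨c', t⟩ ⟨h1, h2⟩
      obtain rfl : c' = c := hcu c' h1
      simp only [← hK] at h2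
      refine Prod.ext rfl ?_
      simp only
      rw [eq_div_iff hKi]
      linarith
  · intro x
    simp
  · intro x
    simp only [Function.comp_def, hk]
  · funext b
    simp [χ]
  · intro c
    by_cases hc : c ∈ Set.range m
    · simp only [χ, if_pos hc, hc]
    · simp only [χ, if_neg hc, hc, Prod.mk.injEq]
      simp
end

section
/- Every injective homomorphism of n-loops is a regular monomorphism, concretely: let n ≥ 1, let B and C be n-loops and let m : B → C be an injective homomorphism. Then there exist an n-loop D and homomorphisms u, v : C → D such that u ∘ m = v ∘ m and, for every c : C, u c = v c if and only if c lies in the range of m. -/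
universe u

/-- Every injective homomorphism of n-loops is a regular monomorphism. -/
theorem stmt_7 (n : ℕ) (hn : 1 ≤ n) (B C : Type u)
    (fB : (Fin n → B) → B) (fC : (Fin n → C) → C) (eB : B) (eC : C)
    (hB : ∀ (a : Fin n → B) (i : Fin n), ∃! b : B, fB (Function.update a i b) = a i)
    (hC : ∀ (a : Fin n → C) (i : Fin n), ∃! b : C, fC (Function.update a i b) = a i)
    (heB : ∀ (i : Fin n) (x : B), fB (Function.update (fun _ => eB) i x) = x)
    (heC : ∀ (i : Fin n) (x : C), fC (Function.update (fun _ => eC) i x) = x)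
    (m : B → C) (hmi : Function.Injective m)
    (hm : ∀ x : Fin n → B, m (fB x) = fC (m ∘ x)) (hme : m eB = eC) :
    ∃ (D : Type u) (fD : (Fin n → D) → D) (eD : D) (u v : C → D),
      (∀ (a : Fin n → D) (i : Fin n), ∃! b : D, fD (Function.update a i b) = a i) ∧
      (∀ (i : Fin n) (x : D), fD (Function.update (fun _ => eD) i x) = x) ∧
      (∀ x : Fin n → C, u (fC x) = fD (u ∘ x)) ∧ u eC = eD ∧
      (∀ x : Fin n → C, v (fC x) = fD (v ∘ x)) ∧ v eC = eD ∧
      u ∘ m = v ∘ m ∧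
      (∀ c : C, u c = v c ↔ c ∈ Set.range m) := by
  classical
  let g : C → ℚ := fun c => if c ∈ Set.range m then 0 else 1
  have g0 : ∀ c, c ∈ Set.range m → g c = 0 := fun c h => if_pos h
  have g1 : ∀ c, c ∉ Set.range m → g c = 1 := fun c h => if_neg h
  have key : ∀ c : Fin n → C, ∃ w : Fin n → ℚ, (∀ i, w i ≠ 0) ∧
      (∑ i, w i * g (c i) = g (fC c)) ∧
      (∀ i x, c = Function.update (fun _ => eC) i x → w i = 1) := by
    intro c
    by_cases h : ∃ i j, i ≠ j ∧ c i ∉ Set.range m ∧ c j ∉ Set.range m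
    · obtain ⟨i, j, hij, hi, hj⟩ := h
      have hw : ∀ r : ℚ, ∃ α β : ℚ, α ≠ 0 ∧ β ≠ 0 ∧ α + β = r := by
        intro r
        by_cases hr : r = 1
        · exact ⟨-1, 2, by norm_num, by norm_num, by rw [hr]; norm_num⟩
        · exact ⟨r - 1, 1, sub_ne_zero.2 hr, one_ne_zero, by ring⟩
      obtain ⟨α, β, hα, hβ, hab⟩ := hw (g (fC c) - ∑ k ∈ (Finset.univ.erase i).erase j, g (c k))
      refine ⟨fun k => if k = i then α else if k = j then β else 1, ?_, ?_, ?_⟩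
      · intro k
        dsimp only
        split_ifs
        · exact hα
        · exact hβ
        · exact one_ne_zero
      · rw [← Finset.add_sum_erase _ _ (Finset.mem_univ i),
          ← Finset.add_sum_erase _ _ (Finset.mem_erase.2 ⟨hij.symm, Finset.mem_univ j⟩)]
        have : ∑ k ∈ (Finset.univ.erase i).erase j,
            (if k = i then α else if k = j then β else 1) * g (c k)
            = ∑ k ∈ (Finset.univ.erase i).erase j, g (c k) := by
          apply Finset.sum_congr rfl
          intro k hk
          simp only [Finset.mem_erase] at hk
          rw [if_neg hk.2.1, if_neg hk.1, one_mul]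
        rw [this, g1 _ hi, g1 _ hj]
        simp only [if_true, if_neg hij.symm]
        linarith
      · intro k x hk
        exfalso
        have hz : ∀ l, l ≠ k → c l ∈ Set.range m := by
          intro l hl
          rw [hk, Function.update_of_ne hl]
          exact ⟨eB, hme⟩
        by_cases hik : i = k
        · exact hj (hz j (fun h => hij (hik.trans h.symm)))
        · exact hi (hz i hik)
    · refine ⟨fun _ => 1, fun _ => one_ne_zero, ?_, fun _ _ _ => rfl⟩
      simp only [one_mul]
      by_cases h2 : ∃ i, c i ∉ Set.range m
      · obtain ⟨i, hi⟩ := h2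
        have ho : ∀ j, j ≠ i → c j ∈ Set.range m := by
          intro j hj
          by_contra hc
          exact h ⟨j, i, hj, hc, hi⟩
        rw [Finset.sum_eq_single i (fun j _ hj => g0 _ (ho j hj)) (by simp), g1 _ hi, g1]
        rintro ⟨b, hb⟩
        have ho' : ∀ j, ∃ y, j ≠ i → m y = c j := by
          intro j
          by_cases hj : j = i
          · exact ⟨eB, fun h => absurd hj h⟩
          · obtain ⟨y, hy⟩ := ho j hj
            exact ⟨y, fun _ => hy⟩
        choose p hp using ho'
        obtain ⟨y, hy, -⟩ := hB (Function.update p i b) i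
        simp only [Function.update_idem, Function.update_self] at hy
        have h3 : fC (Function.update c i (m y)) = fC c := by
          rw [← hb, ← hy, hm]
          congr 1
          funext j
          by_cases hj : j = i
          · subst hj; simp
          · simp [hj, hp j hj]
        have h4 := (hC (Function.update c i (fC c)) i).unique (y₁ := m y) (y₂ := c i)
          (by simpa using h3) (by simp)
        exact hi ⟨y, h4⟩
      · push Not at h2
        rw [Finset.sum_eq_zero (fun j _ => g0 _ (h2 j)), g0]
        choose p hp using h2
        refine ⟨fB p, ?_⟩
        rw [hm]
        congr 1
        funext j
        exact hp j
  choose w hw0 hws hwe using key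
  refine ⟨C × ℚ, fun a => (fC (fun i => (a i).1), ∑ i, w (fun i => (a i).1) i * (a i).2), (eC, 0),
    fun c => (c, 0), fun c => (c, g c), ?_, ?_, ?_, rfl, ?_, ?_, ?_, ?_⟩
  · intro a i
    have hfst : ∀ b : C × ℚ, (fun k => (Function.update a i b k).1)
        = Function.update (fun k => (a k).1) i b.1 := by
      intro b
      funext k
      by_cases hk : k = i
      · subst hk; simp
      · simp [hk]
    have hsum : ∀ (b : C × ℚ) (z : Fin n → ℚ), ∑ k, z k * (Function.update a i b k).2
        = z i * b.2 + ∑ k ∈ Finset.univ.erase i, z k * (a k).2 := by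
      intro b z
      rw [← Finset.add_sum_erase _ _ (Finset.mem_univ i), Function.update_self]
      congr 1
      apply Finset.sum_congr rfl
      intro k hk
      rw [Function.update_of_ne (Finset.ne_of_mem_erase hk)]
    obtain ⟨x, hx, hxu⟩ := hC (fun k => (a k).1) i
    simp only [hfst, hsum]
    have hne := hw0 (Function.update (fun k => (a k).1) i x) i
    refine ⟨(x, ((a i).2 - ∑ k ∈ Finset.univ.erase i,
      w (Function.update (fun k => (a k).1) i x) k * (a k).2) /
      w (Function.update (fun k => (a k).1) i x) i), ?_, ?_⟩
    · refine Prod.ext hx ?_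
      dsimp only
      rw [mul_div_cancel₀ _ hne]
      ring
    · rintro ⟨y, r⟩ hy
      have hy1 := hxu y (congrArg Prod.fst hy)
      subst hy1
      have hy2 := congrArg Prod.snd hy
      dsimp only at hy2
      refine Prod.ext rfl ?_
      dsimp only
      rw [eq_div_iff hne]
      linarith
  · rintro i ⟨x, r⟩
    have hfst : (fun k => (Function.update (fun _ => ((eC, 0) : C × ℚ)) i (x, r) k).1)
        = Function.update (fun _ => eC) i x := by
      funext k
      by_cases hk : k = i
      · subst hk; simp
      · simp [hk]
    simp only [hfst]
    refine Prod.ext (heC i x) ?_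
    dsimp only
    rw [Finset.sum_eq_single i (fun j _ hj => by simp [hj]) (by simp), hwe _ i x rfl]
    simp
  · intro x
    simp
  · intro x
    exact Prod.ext rfl (hws x).symm
  · exact Prod.ext rfl (g0 _ ⟨eB, hme⟩)
  · funext b
    exact Prod.ext rfl (g0 _ ⟨b, rfl⟩).symm
  · intro c
    constructor
    · intro h
      by_contra hc
      have := congrArg Prod.snd h
      dsimp only at this
      rw [g1 c hc] at this
      exact zero_ne_one this
    · intro h
      exact Prod.ext rfl (g0 _ h).symm
end

section
/- Let Q be a finite type, let f : Q ≃ Q be a permutation of Q, and let r : Q → Q → Prop be an equivalence relation such that for all a b : Q, r a b implies r (f a) (f b). Then for all a b : Q, r a b implies r (f.symm a) (f.symm b). -/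
/-- Proposition 3.6: On a finite 1-quasigroup, every {f}-congruence is an
𝔽-congruence. -/
theorem stmt_8 (Q : Type*) [Finite Q] (f : Q ≃ Q) (r : Q → Q → Prop)
    (hr : Equivalence r) (hf : ∀ a b : Q, r a b → r (f a) (f b)) :
    ∀ a b : Q, r a b → r (f.symm a) (f.symm b) := by
  intro a b hab
  let g : Equiv.Perm Q := f
  have hpow : ∀ n : ℕ, r ((g ^ n) a) ((g ^ n) b) := by
    intro n
    induction n with
    | zero => simpa using hab
    | succ k ih =>
      rw [pow_succ', Equiv.Perm.mul_apply, Equiv.Perm.mul_apply]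
      exact hf _ _ ih
  obtain ⟨n, hn, h1⟩ := (isOfFinOrder_iff_pow_eq_one).1 (isOfFinOrder_of_finite g)
  obtain ⟨m, rfl⟩ : ∃ m, n = m + 1 := ⟨n - 1, by omega⟩
  have key : ∀ x, f.symm x = (g ^ m) x := by
    intro x
    rw [Equiv.symm_apply_eq]
    have h2 : (g ^ (m + 1)) x = x := by rw [h1]; rfl
    rw [pow_succ', Equiv.Perm.mul_apply] at h2
    exact h2.symm
  rw [key, key]
  exact hpow m
end

section
/- Every injective equivariant map of 1-quasigroups satisfies the 𝔽-congruence extension property: let Q and Q' be types, let σ : Q ≃ Q and σ' : Q' ≃ Q' be permutations, and let h : Q → Q' be injective with h (σ a) = σ' (h a) for all a : Q. Let r : Q → Q → Prop be an equivalence relation such that r a b implies both r (σ a) (σ b) and r (σ.symm a) (σ.symm b). Then there exists an equivalence relation r' : Q' → Q' → Prop such that r' x y implies both r' (σ' x) (σ' y) and r' (σ'.symm x) (σ'.symm y), and such that for all a b : Q, r' (h a) (h b) ↔ r a b. -/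
/-- Every injective homomorphism of 1-quasigroups satisfies the 𝔽-congruence
extension property. -/
theorem stmt_10 (Q Q' : Type*) (σ : Q ≃ Q) (σ' : Q' ≃ Q') (h : Q → Q')
    (hinj : Function.Injective h) (hhom : ∀ a : Q, h (σ a) = σ' (h a))
    (r : Q → Q → Prop) (hr : Equivalence r)
    (hcong : ∀ a b : Q, r a b → r (σ a) (σ b) ∧ r (σ.symm a) (σ.symm b)) :
    ∃ r' : Q' → Q' → Prop, Equivalence r' ∧
      (∀ x y : Q', r' x y → r' (σ' x) (σ' y) ∧ r' (σ'.symm x) (σ'.symm y)) ∧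
      (∀ a b : Q, r' (h a) (h b) ↔ r a b) := by
  have hsymm : ∀ a : Q, h (σ.symm a) = σ'.symm (h a) := by
    intro a
    rw [Equiv.eq_symm_apply, ← hhom, Equiv.apply_symm_apply]
  refine ⟨fun x y => x = y ∨ ∃ a b, h a = x ∧ h b = y ∧ r a b, ⟨?_, ?_, ?_⟩, ?_, ?_⟩
  · intro x
    exact Or.inl rfl
  · rintro x y (rfl | ⟨a, b, ha, hb, hab⟩)
    · exact Or.inl rfl
    · exact Or.inr ⟨b, a, hb, ha, hr.symm hab⟩
  · rintro x y z (rfl | ⟨a, b, ha, hb, hab⟩) hyz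
    · exact hyz
    · rcases hyz with rfl | ⟨c, d, hc, hd, hcd⟩
      · exact Or.inr ⟨a, b, ha, hb, hab⟩
      · have hbc : b = c := hinj (hb.trans hc.symm)
        subst hbc
        exact Or.inr ⟨a, d, ha, hd, hr.trans hab hcd⟩
  · rintro x y (rfl | ⟨a, b, rfl, rfl, hab⟩)
    · exact ⟨Or.inl rfl, Or.inl rfl⟩
    · exact ⟨Or.inr ⟨σ a, σ b, hhom a, hhom b, (hcong a b hab).1⟩,
        Or.inr ⟨σ.symm a, σ.symm b, hsymm a, hsymm b, (hcong a b hab).2⟩⟩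
  · intro a b
    constructor
    · rintro (hab | ⟨c, d, hc, hd, hcd⟩)
      · rw [hinj hab]
        exact hr.refl b
      · rw [← hinj hc, ← hinj hd]
        exact hcd
    · intro hab
      exact Or.inr ⟨a, b, rfl, rfl, hab⟩
end

section
/- Let n ≥ 2. The term rewriting system Σ_Q(n), consisting of the rules (2.3) and (2.4) for all i : Fin n, is not confluent: there exist terms t, t₁, t₂ with t →* t₁ and t →* t₂ for which no term t' satisfies t₁ →* t' and t₂ →* t'. -/
open FirstOrder FirstOrder.Language

/-- Function symbols of the language of n-quasigroups: one n-ary symbol `f` and one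
n-ary symbol `g i` for each `i : Fin n`. -/
inductive QFun (n : ℕ) : ℕ → Type
  | f : QFun n n
  | g : Fin n → QFun n n

/-- The language of n-quasigroups. -/
def QLang (n : ℕ) : FirstOrder.Language where
  Functions := QFun n
  Relations := fun _ => Empty

/-- The one-step rewrite relation generated by a set `R` of rewrite rules. -/
inductive Rw {L : FirstOrder.Language} (R : Set (L.Term ℕ × L.Term ℕ)) :
    L.Term ℕ → L.Term ℕ → Prop
  | inst {l r : L.Term ℕ} (hlr : (l, r) ∈ R) (θ : ℕ → L.Term ℕ) :
      Rw R (l.subst θ) (r.subst θ)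
  | congr {m : ℕ} (F : L.Functions m) (ts : Fin m → L.Term ℕ) (i : Fin m) {t' : L.Term ℕ} :
      Rw R (ts i) t' → Rw R (Term.func F ts) (Term.func F (Function.update ts i t'))

/-- The tuple of variables `x_0, ..., x_{n-1}`. -/
def vQ (n : ℕ) : Fin n → (QLang n).Term ℕ := fun k => Term.var (k : ℕ)

/-- Rule (2.3): `f(x_0, ..., g_i(x_0, ..., x_{n-1}), ..., x_{n-1}) → x_i`. -/
def rule23 (n : ℕ) (i : Fin n) : (QLang n).Term ℕ × (QLang n).Term ℕ :=
  (Term.func (QFun.f : QFun n n) (Function.update (vQ n) i (Term.func (QFun.g i) (vQ n))),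
    vQ n i)

/-- Rule (2.4): `g_i(x_0, ..., f(x_0, ..., x_{n-1}), ..., x_{n-1}) → x_i`. -/
def rule24 (n : ℕ) (i : Fin n) : (QLang n).Term ℕ × (QLang n).Term ℕ :=
  (Term.func (QFun.g i) (Function.update (vQ n) i (Term.func (QFun.f : QFun n n) (vQ n))),
    vQ n i)

/-- The term rewriting system Σ_Q(n), consisting of rules (2.3) and (2.4) for all `i`. -/
def SigmaQ (n : ℕ) : Set ((QLang n).Term ℕ × (QLang n).Term ℕ) :=
  { p | ∃ i : Fin n, p = rule23 n i ∨ p = rule24 n i }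

/-- The symbol is a `g`. -/
def QFun.IsG {n : ℕ} : {m : ℕ} → QFun n m → Prop
  | _, QFun.f => False
  | _, QFun.g _ => True

/-- The term does not contain `f`. -/
def NoF {n : ℕ} : (QLang n).Term ℕ → Prop
  | Term.var _ => True
  | Term.func F ts => QFun.IsG (n := n) F ∧ ∀ i, NoF (ts i)

theorem rw_not_noF {n : ℕ} {s s' : (QLang n).Term ℕ} (h : Rw (SigmaQ n) s s') : ¬ NoF s := by
  induction h with
  | inst hlr θ =>
    obtain ⟨i, h | h⟩ := hlr
    · obtain ⟨rfl, rfl⟩ := Prod.mk.inj h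
      intro h
      exact h.1
    · obtain ⟨rfl, rfl⟩ := Prod.mk.inj h
      intro h
      have h2 := h.2 i
      simp only [Function.update_self] at h2
      exact h2.1
  | congr F ts i _ ih =>
    intro h
    exact ih (h.2 i)

theorem noF_normal {n : ℕ} {s s' : (QLang n).Term ℕ} (hs : NoF s)
    (h : Relation.ReflTransGen (Rw (SigmaQ n)) s s') : s' = s := by
  rcases Relation.ReflTransGen.cases_head h with h | ⟨c, h, _⟩
  · exact h.symm
  · exact absurd hs (rw_not_noF h)

/-- Lemma 2.2, 'only if': for n ≥ 2, Σ_Q(n) is not confluent. -/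
theorem stmt_11 (n : ℕ) (hn : 2 ≤ n) :
    ∃ t t₁ t₂ : (QLang n).Term ℕ,
      Relation.ReflTransGen (Rw (SigmaQ n)) t t₁ ∧
      Relation.ReflTransGen (Rw (SigmaQ n)) t t₂ ∧
      ¬ ∃ t' : (QLang n).Term ℕ,
          Relation.ReflTransGen (Rw (SigmaQ n)) t₁ t' ∧
          Relation.ReflTransGen (Rw (SigmaQ n)) t₂ t' := by
  have hij : (⟨0, by omega⟩ : Fin n) ≠ ⟨1, by omega⟩ := by simp
  generalize (⟨0, by omega⟩ : Fin n) = i at hij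
  generalize (⟨1, by omega⟩ : Fin n) = j at hij
  let gj : (QLang n).Term ℕ := Term.func (QFun.g j : QFun n n) (vQ n)
  let x : Fin n → (QLang n).Term ℕ := Function.update (vQ n) j gj
  let fx : (QLang n).Term ℕ := Term.func (QFun.f : QFun n n) x
  have hgj : NoF gj := ⟨trivial, fun _ => trivial⟩
  have hx : ∀ k, NoF (x k) := by
    intro k
    by_cases hk : k = j
    · subst hk; simpa [x] using hgj
    · simp only [x, Function.update_of_ne hk]; trivial
  refine ⟨Term.func (QFun.g i : QFun n n) (Function.update x i fx), vQ n i,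
    Term.func (QFun.g i : QFun n n) (Function.update x i (vQ n j)), ?_, ?_, ?_⟩
  · refine Relation.ReflTransGen.single ?_
    let θ : ℕ → (QLang n).Term ℕ := fun k => if h : k < n then x ⟨k, h⟩ else Term.var k
    have hθ : ∀ k : Fin n, (vQ n k).subst θ = x k := by
      intro k
      simp [vQ, Term.subst, θ]
    have key := Rw.inst (R := SigmaQ n) (l := (rule24 n i).1) (r := (rule24 n i).2)
      ⟨i, Or.inr rfl⟩ θ
    have e1 : (rule24 n i).1.subst θ =
        Term.func (QFun.g i : QFun n n) (Function.update x i fx) := by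
      simp only [rule24, Term.subst]
      congr 1
      funext k
      by_cases hk : k = i
      · subst hk
        simp only [Function.update_self, Term.subst, fx]
        congr 1
        funext m
        exact hθ m
      · simp only [Function.update_of_ne hk]
        exact hθ k
    have e2 : (rule24 n i).2.subst θ = vQ n i := by
      simp only [rule24, hθ, x, Function.update_of_ne hij]
    rwa [e1, e2] at key
  · refine Relation.ReflTransGen.single ?_
    have key := Rw.inst (R := SigmaQ n) (l := (rule23 n j).1) (r := (rule23 n j).2)
      ⟨j, Or.inl rfl⟩ Term.var
    have hs : ∀ t : (QLang n).Term ℕ, t.subst Term.var = t := by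
      intro t
      induction t with
      | var => rfl
      | func F ts ih => simp only [Term.subst, ih]
    rw [hs, hs] at key
    have h2 := Rw.congr (R := SigmaQ n) (QFun.g i : QFun n n) (Function.update x i fx) i
      (t' := vQ n j) (by rw [Function.update_self]; exact key)
    rwa [Function.update_idem] at h2
  · rintro ⟨t', h1, h2⟩
    have e1 := noF_normal (n := n) (s := vQ n i) trivial h1
    have e2 := noF_normal (n := n) (s := Term.func (QFun.g i : QFun n n)
        (Function.update x i (vQ n j))) ⟨trivial, by
      intro k
      by_cases hk : k = i
      · subst hk; simp only [Function.update_self]; trivial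
      · simp only [Function.update_of_ne hk]; exact hx k⟩ h2
    rw [e1] at e2
    cases e2
end

section
/- For n = 1, the term rewriting system Σ_Q(1), consisting of the two rules f(g(x)) → x and g(f(x)) → x, is confluent: for all terms t, t₁, t₂ with t →* t₁ and t →* t₂ there exists t' with t₁ →* t' and t₂ →* t'. -/
open FirstOrder FirstOrder.Language

/-- Rule (2.3) for n = 1: `f(g(x)) → x`. -/
def rule23one : (QLang 1).Term ℕ × (QLang 1).Term ℕ :=
  (Term.func (QFun.f : QFun 1 1) (fun _ => Term.func (QFun.g 0) (fun _ => Term.var 0)),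
    Term.var 0)

/-- Rule (2.4) for n = 1: `g(f(x)) → x`. -/
def rule24one : (QLang 1).Term ℕ × (QLang 1).Term ℕ :=
  (Term.func (QFun.g (0 : Fin 1)) (fun _ => Term.func (QFun.f : QFun 1 1) (fun _ => Term.var 0)),
    Term.var 0)

/-- The term rewriting system Σ_Q(1). -/
def SigmaQ1 : Set ((QLang 1).Term ℕ × (QLang 1).Term ℕ) := {rule23one, rule24one}

inductive QW : Type
  | v : ℕ → QW
  | a : QW → QW
  | b : QW → QW

inductive QStep : QW → QW → Prop
  | ab (x : QW) : QStep (.a (.b x)) x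
  | ba (x : QW) : QStep (.b (.a x)) x
  | ca {x y : QW} : QStep x y → QStep (.a x) (.a y)
  | cb {x y : QW} : QStep x y → QStep (.b x) (.b y)

def qapp : {m : ℕ} → QFun 1 m → (Fin m → QW) → QW
  | _, .f, ts => .a (ts 0)
  | _, .g _, ts => .b (ts 0)

def toQW : (QLang 1).Term ℕ → QW
  | .var k => .v k
  | .func F ts => qapp F (fun i => toQW (ts i))

def ofQW : QW → (QLang 1).Term ℕ
  | .v k => .var k
  | .a x => Term.func (L := QLang 1) (QFun.f : QFun 1 1) (fun _ => ofQW x)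
  | .b x => Term.func (L := QLang 1) (QFun.g 0 : QFun 1 1) (fun _ => ofQW x)

theorem ofQW_toQW (t : (QLang 1).Term ℕ) : ofQW (toQW t) = t := by
  induction t with
  | var k => rfl
  | func F ts ih =>
    change QFun 1 _ at F
    cases F with
    | f =>
      simp only [toQW, qapp, ofQW]
      congr 1
      funext i
      rw [Subsingleton.elim i 0]; exact ih 0
    | g j =>
      simp only [toQW, qapp, ofQW]
      rw [Subsingleton.elim j 0]
      congr 1
      funext i
      rw [Subsingleton.elim i 0]; exact ih 0

theorem toQW_step {s t : (QLang 1).Term ℕ} (h : Rw SigmaQ1 s t) : QStep (toQW s) (toQW t) := by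
  induction h with
  | inst hlr θ =>
    rcases hlr with h | h
    · obtain ⟨rfl, rfl⟩ := Prod.mk.inj h
      exact QStep.ab _
    · obtain ⟨rfl, rfl⟩ := Prod.mk.inj h
      exact QStep.ba _
  | congr F ts i h ih =>
    change QFun 1 _ at F
    cases F with
    | f =>
      obtain rfl := Subsingleton.elim i 0
      simp only [toQW, qapp, Function.update_self]
      exact QStep.ca ih
    | g j =>
      obtain rfl := Subsingleton.elim i 0
      simp only [toQW, qapp, Function.update_self]
      exact QStep.cb ih

theorem ofQW_step {s t : QW} (h : QStep s t) : Rw SigmaQ1 (ofQW s) (ofQW t) := by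
  induction h with
  | ab x =>
    exact Rw.inst (R := SigmaQ1) (l := rule23one.1) (r := rule23one.2) (Or.inl rfl) (fun _ => ofQW x)
  | ba x =>
    exact Rw.inst (R := SigmaQ1) (l := rule24one.1) (r := rule24one.2) (Or.inr rfl) (fun _ => ofQW x)
  | @ca x y h ih =>
    have := Rw.congr (R := SigmaQ1) (m := 1) (QFun.f : QFun 1 1) (fun _ => ofQW x) 0 ih
    have e : Function.update (fun _ : Fin 1 => ofQW x) 0 (ofQW y) = fun _ => ofQW y := by
      funext i
      rw [Subsingleton.elim i 0, Function.update_self]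
    rw [e] at this
    exact this
  | @cb x y h ih =>
    have := Rw.congr (R := SigmaQ1) (m := 1) (QFun.g 0 : QFun 1 1) (fun _ => ofQW x) 0 ih
    have e : Function.update (fun _ : Fin 1 => ofQW x) 0 (ofQW y) = fun _ => ofQW y := by
      funext i
      rw [Subsingleton.elim i 0, Function.update_self]
    rw [e] at this
    exact this

theorem QStep_diamond {s t u : QW} (h : QStep s t) (h' : QStep s u) :
    t = u ∨ ∃ w, QStep t w ∧ QStep u w := by
  induction h generalizing u with
  | ab x =>
    cases h' with
    | ab => exact Or.inl rfl
    | ca h =>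
      cases h with
      | ba => exact Or.inl rfl
      | cb h => exact Or.inr ⟨_, h, QStep.ab _⟩
  | ba x =>
    cases h' with
    | ba => exact Or.inl rfl
    | cb h =>
      cases h with
      | ab => exact Or.inl rfl
      | ca h => exact Or.inr ⟨_, h, QStep.ba _⟩
  | ca h ih =>
    cases h' with
    | ab =>
      cases h with
      | ba => exact Or.inl rfl
      | cb h => exact Or.inr ⟨_, QStep.ab _, h⟩
    | ca h2 =>
      rcases ih h2 with rfl | ⟨w, h3, h4⟩
      · exact Or.inl rfl
      · exact Or.inr ⟨_, h3.ca, h4.ca⟩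
  | cb h ih =>
    cases h' with
    | ba =>
      cases h with
      | ab => exact Or.inl rfl
      | ca h => exact Or.inr ⟨_, QStep.ba _, h⟩
    | cb h2 =>
      rcases ih h2 with rfl | ⟨w, h3, h4⟩
      · exact Or.inl rfl
      · exact Or.inr ⟨_, h3.cb, h4.cb⟩

/-- Lemma 2.2, 'if': the system Σ_Q(1) is confluent. -/
theorem stmt_12 :
    ∀ t t₁ t₂ : (QLang 1).Term ℕ,
      Relation.ReflTransGen (Rw SigmaQ1) t t₁ →
      Relation.ReflTransGen (Rw SigmaQ1) t t₂ →
      ∃ t' : (QLang 1).Term ℕ,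
        Relation.ReflTransGen (Rw SigmaQ1) t₁ t' ∧
        Relation.ReflTransGen (Rw SigmaQ1) t₂ t' := by
  intro t t₁ t₂ h₁ h₂
  have k₁ := Relation.ReflTransGen.lift (p := QStep) toQW (fun _ _ h => toQW_step h) _ _ h₁
  have k₂ := Relation.ReflTransGen.lift (p := QStep) toQW (fun _ _ h => toQW_step h) _ _ h₂
  obtain ⟨w, w₁, w₂⟩ := Relation.church_rosser (r := QStep) (fun x y z hy hz => by
    rcases QStep_diamond hy hz with rfl | ⟨w, h3, h4⟩
    · exact ⟨y, .refl, .refl⟩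
    · exact ⟨w, .single h3, .single h4⟩) k₁ k₂
  refine ⟨ofQW w, ?_, ?_⟩
  · have := Relation.ReflTransGen.lift (p := Rw SigmaQ1) ofQW (fun _ _ h => ofQW_step h) _ _ w₁
    rwa [Function.onFun, ofQW_toQW] at this
  · have := Relation.ReflTransGen.lift (p := Rw SigmaQ1) ofQW (fun _ _ h => ofQW_step h) _ _ w₂
    rwa [Function.onFun, ofQW_toQW] at this
end

section
/- Let n ≥ 2. The term rewriting system Σ_Q⁺(n), consisting of rules (2.3) and (2.4) for all i : Fin n together with rules (2.7)/(2.8) for all i ≠ j, is confluent: for all terms t, t₁, t₂ with t →* t₁ and t →* t₂ there exists t' with t₁ →* t' and t₂ →* t'. -/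
open FirstOrder FirstOrder.Language

/-- Rule (2.7)/(2.8): the argument tuple of `g_i` is `x_k` at positions `k ∉ {i, j}`,
`x_j` at position `i`, and `g_j(x_0, ..., x_{n-1})` at position `j`; it rewrites to `x_i`. -/
def rule2728 (n : ℕ) (i j : Fin n) : (QLang n).Term ℕ × (QLang n).Term ℕ :=
  (Term.func (QFun.g i)
      (Function.update (Function.update (vQ n) i (vQ n j)) j (Term.func (QFun.g j) (vQ n))),
    vQ n i)

/-- The term rewriting system Σ_Q⁺(n): rules (2.3), (2.4) for all `i`, and
rules (2.7)/(2.8) for all `i ≠ j`. -/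
def SigmaQplus (n : ℕ) : Set ((QLang n).Term ℕ × (QLang n).Term ℕ) :=
  { p | ∃ i : Fin n, p = rule23 n i ∨ p = rule24 n i } ∪
  { p | ∃ i j : Fin n, i ≠ j ∧ p = rule2728 n i j }


abbrev QT_s13 (n : ℕ) := (QLang n).Term ℕ

abbrev QF {n : ℕ} (u : Fin n → QT_s13 n) : QT_s13 n := Term.func (L := QLang n) (QFun.f : QFun n n) u
abbrev QG {n : ℕ} (i : Fin n) (u : Fin n → QT_s13 n) : QT_s13 n :=
  Term.func (L := QLang n) (QFun.g i : QFun n n) u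

def QRoot {n : ℕ} : {m : ℕ} → QFun n m → (Fin m → QT_s13 n) → QT_s13 n → Prop
  | _, .f, ts, r => ∃ (i : Fin n) (u : Fin n → QT_s13 n), ts = Function.update u i (QG i u) ∧ r = u i
  | _, .g i, ts, r => (∃ u : Fin n → QT_s13 n, ts = Function.update u i (QF u) ∧ r = u i) ∨
      ∃ (j : Fin n) (u : Fin n → QT_s13 n), i ≠ j ∧
        ts = Function.update (Function.update u i (u j)) j (QG j u) ∧ r = u i

def qsz {n : ℕ} : QT_s13 n → ℕ
  | .var _ => 0
  | .func _ ts => 1 + ∑ i, qsz (ts i)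

theorem qsz_lt {n m : ℕ} (F : (QLang n).Functions m) (ts : Fin m → QT_s13 n) (i : Fin m) :
    qsz (ts i) < qsz (Term.func F ts) := by
  have := Finset.single_le_sum (f := fun i => qsz (ts i)) (fun _ _ => Nat.zero_le _)
    (Finset.mem_univ i)
  simp only [qsz]
  beta_reduce at this
  omega

theorem qsz_F {n : ℕ} (u : Fin n → QT_s13 n) (i : Fin n) : qsz (u i) < qsz (QF u) :=
  qsz_lt _ u i

theorem qsz_G {n : ℕ} (j : Fin n) (u : Fin n → QT_s13 n) (i : Fin n) : qsz (u i) < qsz (QG j u) :=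
  qsz_lt _ u i

theorem QF_inj {n : ℕ} {u w : Fin n → QT_s13 n} (h : QF u = QF w) : u = w := by
  cases h
  rfl

theorem QG_inj {n : ℕ} {i j : Fin n} {u w : Fin n → QT_s13 n} (h : QG i u = QG j w) :
    i = j ∧ u = w := by
  cases h
  exact ⟨rfl, rfl⟩

theorem QFG {n : ℕ} {j : Fin n} {u w : Fin n → QT_s13 n} : QF u ≠ QG j w := by
  intro h
  cases h

theorem qroot_unique {n m : ℕ} (F : QFun n m) (ts : Fin m → QT_s13 n) (r r' : QT_s13 n)
    (h : QRoot F ts r) (h' : QRoot F ts r') : r = r' := by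
  cases F with
  | f =>
    obtain ⟨i, u, h1, rfl⟩ := h
    obtain ⟨j, w, h2, rfl⟩ := h'
    by_cases hij : i = j
    · subst hij
      have e : ts i = QG i u := by simp [h1]
      have e' : ts i = QG i w := by simp [h2]
      rw [(QG_inj (e.symm.trans e')).2]
    · exfalso
      have e1 : ts i = QG i u := by simp [h1]
      have e2 : ts j = QG j w := by simp [h2]
      have e3 : ts j = u j := by simp [h1, Ne.symm hij]
      have e4 : ts i = w i := by simp [h2, hij]
      have a := qsz_G i u j
      have b := qsz_G j w i
      rw [← e3, ← e1] at a
      rw [← e4, ← e2] at b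
      omega
  | g i =>
    have key : ∀ (j : Fin n) (u w : Fin n → QT_s13 n), i ≠ j → ts = Function.update u i (QF u) →
        ts = Function.update (Function.update w i (w j)) j (QG j w) → False := by
      intro j u w hij h1 h2
      have e1 : ts i = QF u := by simp [h1]
      have e2 : ts j = QG j w := by simp [h2]
      have e3 : ts j = u j := by simp [h1, Ne.symm hij]
      have e4 : ts i = w j := by simp [h2, hij]
      have a := qsz_F u j
      have b := qsz_G j w j
      rw [← e3, ← e1] at a
      rw [← e4, ← e2] at b
      omega
    rcases h with ⟨u, h1, rfl⟩ | ⟨j, u, hij, h1, rfl⟩ <;>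
    rcases h' with ⟨w, h2, rfl⟩ | ⟨l, w, hil, h2, rfl⟩
    · have e : ts i = QF u := by simp [h1]
      have e' : ts i = QF w := by simp [h2]
      rw [QF_inj (e.symm.trans e')]
    · exact (key _ _ _ hil h1 h2).elim
    · exact (key _ _ _ hij h2 h1).elim
    · have e1 : ts j = QG j u := by simp [h1]
      have e2 : ts l = QG l w := by simp [h2]
      by_cases hjl : j = l
      · subst hjl
        rw [(QG_inj (e1.symm.trans e2)).2]
      · exfalso
        have e3 : ts l = u l := by simp [h1, Ne.symm hjl, Ne.symm hil]
        have e4 : ts j = w j := by simp [h2, hjl, Ne.symm hij]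
        have a := qsz_G j u l
        have b := qsz_G l w j
        rw [← e3, ← e1] at a
        rw [← e4, ← e2] at b
        omega

open Classical in
noncomputable def qred {n m : ℕ} (F : QFun n m) (ts : Fin m → QT_s13 n) : QT_s13 n :=
  if h : ∃ r, QRoot F ts r then h.choose else Term.func (L := QLang n) F ts

theorem qred_root {n m : ℕ} {F : QFun n m} {ts : Fin m → QT_s13 n} {r : QT_s13 n} (h : QRoot F ts r) :
    qred F ts = r := by
  have h' : ∃ r, QRoot F ts r := ⟨r, h⟩
  rw [qred, dif_pos h']
  exact qroot_unique F ts _ _ h'.choose_spec h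

theorem qred_not {n m : ℕ} {F : QFun n m} {ts : Fin m → QT_s13 n} (h : ∀ r, ¬ QRoot F ts r) :
    qred F ts = Term.func (L := QLang n) F ts := by
  rw [qred, dif_neg (by simpa using h)]

noncomputable def qnf {n : ℕ} : QT_s13 n → QT_s13 n
  | .var x => .var x
  | .func F ts => qred F (fun i => qnf (ts i))

def QNm {n : ℕ} : QT_s13 n → Prop
  | .var _ => True
  | .func F ts => (∀ i, QNm (ts i)) ∧ ∀ r, ¬ QRoot (n := n) F ts r

theorem qroot_sub {n m : ℕ} {F : QFun n m} {ts : Fin m → QT_s13 n} {r : QT_s13 n} (h : QRoot F ts r)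
    (hN : ∀ i, QNm (ts i)) : QNm r := by
  cases F with
  | f =>
    obtain ⟨i, u, h1, rfl⟩ := h
    have e1 : ts i = QG i u := by simp [h1]
    have := hN i
    rw [e1] at this
    exact this.1 i
  | g i =>
    rcases h with ⟨u, h1, rfl⟩ | ⟨j, u, hij, h1, rfl⟩
    · have e1 : ts i = QF u := by simp [h1]
      have := hN i
      rw [e1] at this
      exact this.1 i
    · have e1 : ts j = QG j u := by simp [h1]
      have := hN j
      rw [e1] at this
      exact this.1 i

theorem qred_nm {n m : ℕ} {F : QFun n m} {ts : Fin m → QT_s13 n} 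
    (hN : ∀ i, QNm (ts i)) : QNm (qred F ts) := by
  by_cases h : ∃ r, QRoot F ts r
  · obtain ⟨r, h⟩ := h
    rw [qred_root h]
    exact qroot_sub h hN
  · push Not at h
    rw [qred_not h]
    exact ⟨hN, h⟩

theorem qnf_nm {n : ℕ} (t : QT_s13 n) : QNm (qnf t) := by
  induction t with
  | var x => simp [qnf, QNm]
  | func F ts ih => exact qred_nm ih

theorem qred_F {n : ℕ} {w : Fin n → QT_s13 n} (h : QNm (QF w)) : qred QFun.f w = QF w :=
  qred_not h.2
theorem qred_G {n : ℕ} {i : Fin n} {w : Fin n → QT_s13 n} (h : QNm (QG i w)) :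
    qred (QFun.g i) w = QG i w :=
  qred_not h.2

theorem qcp23 {n : ℕ} (i : Fin n) (a : Fin n → QT_s13 n) (ha : ∀ k, QNm (a k)) :
    qred QFun.f (Function.update a i (qred (QFun.g i) a)) = a i := by
  by_cases h : ∃ r, QRoot (QFun.g i) a r
  · obtain ⟨r, h⟩ := h
    rw [qred_root h]
    rcases h with ⟨w, h1, rfl⟩ | ⟨j, w, hij, h1, rfl⟩
    · have e : a i = QF w := by simp [h1]
      have e2 : Function.update a i (w i) = w := by simp [h1]
      rw [e2, e]
      exact qred_F (e ▸ ha i)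
    · apply qred_root
      refine ⟨j, w, ?_, ?_⟩
      · subst h1
        funext k
        simp only [Function.update_apply]
        split_ifs <;> simp_all
      · simp [h1, hij]
  · push Not at h
    rw [qred_not h]
    exact qred_root ⟨i, a, rfl, rfl⟩

theorem qcp24 {n : ℕ} (i : Fin n) (a : Fin n → QT_s13 n) (ha : ∀ k, QNm (a k)) :
    qred (QFun.g i) (Function.update a i (qred QFun.f a)) = a i := by
  by_cases h : ∃ r, QRoot QFun.f a r
  · obtain ⟨r, h⟩ := h
    rw [qred_root h]
    obtain ⟨j, w, h1, rfl⟩ := h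
    by_cases hij : i = j
    · subst hij
      have e : a i = QG i w := by simp [h1]
      have e2 : Function.update a i (w i) = w := by simp [h1]
      rw [e2, e]
      exact qred_G (e ▸ ha i)
    · apply qred_root
      refine Or.inr ⟨j, w, hij, ?_, ?_⟩
      · subst h1
        funext k
        simp only [Function.update_apply]
        split_ifs <;> simp_all
      · simp [h1, hij]
  · push Not at h
    rw [qred_not h]
    exact qred_root (Or.inl ⟨a, rfl, rfl⟩)

theorem qcp27 {n : ℕ} (i j : Fin n) (hij : i ≠ j) (a : Fin n → QT_s13 n) (ha : ∀ k, QNm (a k)) :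
    qred (QFun.g i) (Function.update (Function.update a i (a j)) j (qred (QFun.g j) a)) = a i := by
  by_cases h : ∃ r, QRoot (QFun.g j) a r
  · obtain ⟨r, h⟩ := h
    rw [qred_root h]
    rcases h with ⟨w, h1, rfl⟩ | ⟨l, w, hjl, h1, rfl⟩
    · apply qred_root
      refine Or.inl ⟨w, ?_, ?_⟩
      · subst h1
        funext k
        simp only [Function.update_apply]
        split_ifs <;> simp_all
      · simp [h1, hij]
    · by_cases hil : i = l
      · subst hil
        have e : a i = QG i w := by simp [h1]
        have e2 : Function.update (Function.update a i (a j)) j (w j) = w := by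
          subst h1
          funext k
          simp only [Function.update_apply]
          split_ifs <;> simp_all
        rw [e2, e]
        exact qred_G (e ▸ ha i)
      · apply qred_root
        refine Or.inr ⟨l, w, hil, ?_, ?_⟩
        · subst h1
          funext k
          simp only [Function.update_apply]
          split_ifs <;> simp_all
        · simp [h1, hij, hil]
  · push Not at h
    rw [qred_not h]
    exact qred_root (Or.inr ⟨j, a, hij, rfl, rfl⟩)

theorem qnf_update {n : ℕ} {m : ℕ} (ts : Fin m → QT_s13 n) (i : Fin m) (t : QT_s13 n) :
    (fun k => qnf (Function.update ts i t k)) =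
      Function.update (fun k => qnf (ts k)) i (qnf t) := by
  funext k
  simp only [Function.update_apply]
  split_ifs <;> rfl

theorem qsubst_update {n : ℕ} {m : ℕ} (ts : Fin m → QT_s13 n) (i : Fin m) (t : QT_s13 n)
    (θ : ℕ → QT_s13 n) :
    (fun k => (Function.update ts i t k).subst θ) =
      Function.update (fun k => (ts k).subst θ) i (t.subst θ) := by
  funext k
  simp only [Function.update_apply]
  split_ifs <;> rfl

theorem qsubst23 {n : ℕ} (i : Fin n) (θ : ℕ → QT_s13 n) :
    (rule23 n i).1.subst θ = QF (Function.update (fun k : Fin n => θ k) i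
      (QG i (fun k : Fin n => θ k))) := by
  simp only [rule23, Term.subst, qsubst_update]
  rfl

theorem qsubst24 {n : ℕ} (i : Fin n) (θ : ℕ → QT_s13 n) :
    (rule24 n i).1.subst θ = QG i (Function.update (fun k : Fin n => θ k) i
      (QF (fun k : Fin n => θ k))) := by
  simp only [rule24, Term.subst, qsubst_update]
  rfl

theorem qsubst27 {n : ℕ} (i j : Fin n) (θ : ℕ → QT_s13 n) :
    (rule2728 n i j).1.subst θ = QG i (Function.update
      (Function.update (fun k : Fin n => θ k) i (θ j)) j
      (QG j (fun k : Fin n => θ k))) := by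
  simp only [rule2728, Term.subst, qsubst_update]
  rfl

theorem qnf_rw {n : ℕ} {t s : QT_s13 n} (h : Rw (SigmaQplus n) t s) : qnf t = qnf s := by
  induction h with
  | @inst l r hlr θ =>
    have ha : ∀ k : Fin n, QNm (qnf (θ k)) := fun k => qnf_nm _
    rcases hlr with ⟨i, h | h⟩ | ⟨i, j, hij, h⟩
    · have h1 : l = (rule23 n i).1 := by rw [← h]
      have h2 : r = (rule23 n i).2 := by rw [← h]
      subst h1 h2
      rw [qsubst23]
      simp only [qnf, qnf_update]
      exact qcp23 i (fun k : Fin n => qnf (θ k)) ha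
    · have h1 : l = (rule24 n i).1 := by rw [← h]
      have h2 : r = (rule24 n i).2 := by rw [← h]
      subst h1 h2
      rw [qsubst24]
      simp only [qnf, qnf_update]
      exact qcp24 i (fun k : Fin n => qnf (θ k)) ha
    · have h1 : l = (rule2728 n i j).1 := by rw [← h]
      have h2 : r = (rule2728 n i j).2 := by rw [← h]
      subst h1 h2
      rw [qsubst27]
      simp only [qnf, qnf_update]
      exact qcp27 i j hij (fun k : Fin n => qnf (θ k)) ha
  | @congr m F ts i t' _ ih =>
    simp only [qnf, qnf_update]
    rw [← ih]
    congr 1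
    exact (Function.update_eq_self i (fun k => qnf (ts k))).symm

theorem qroot_rw {n m : ℕ} {F : QFun n m} {ts : Fin m → QT_s13 n} {r : QT_s13 n} (h : QRoot F ts r) :
    Rw (SigmaQplus n) (Term.func (L := QLang n) F ts) r := by
  have hθ : ∀ u : Fin n → QT_s13 n, ∃ θ : ℕ → QT_s13 n, (fun k : Fin n => θ k) = u := by
    intro u
    refine ⟨fun k => if h : k < n then u ⟨k, h⟩ else Term.var k, ?_⟩
    funext k
    simp
  cases F with
  | f =>
    obtain ⟨i, u, rfl, rfl⟩ := h
    obtain ⟨θ, rfl⟩ := hθ u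
    have := Rw.inst (R := SigmaQplus n) (l := (rule23 n i).1) (r := (rule23 n i).2)
      (Or.inl ⟨i, Or.inl rfl⟩) θ
    rw [qsubst23] at this
    exact this
  | g i =>
    rcases h with ⟨u, rfl, rfl⟩ | ⟨j, u, hij, rfl, rfl⟩
    · obtain ⟨θ, rfl⟩ := hθ u
      have := Rw.inst (R := SigmaQplus n) (l := (rule24 n i).1) (r := (rule24 n i).2)
        (Or.inl ⟨i, Or.inr rfl⟩) θ
      rw [qsubst24] at this
      exact this
    · obtain ⟨θ, rfl⟩ := hθ u
      have := Rw.inst (R := SigmaQplus n) (l := (rule2728 n i j).1) (r := (rule2728 n i j).2)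
        (Or.inr ⟨i, j, hij, rfl⟩) θ
      rw [qsubst27] at this
      exact this

theorem qcongr1 {n m : ℕ} {R : Set (QT_s13 n × QT_s13 n)} (F : (QLang n).Functions m)
    (ts : Fin m → QT_s13 n) (i : Fin m) (t : QT_s13 n) (h : Relation.ReflTransGen (Rw R) (ts i) t) :
    Relation.ReflTransGen (Rw R) (Term.func F ts) (Term.func F (Function.update ts i t)) := by
  induction h with
  | refl => simpa using Relation.ReflTransGen.refl
  | @tail b c _ hbc ih =>
    refine ih.tail ?_
    have := Rw.congr (R := R) F (Function.update ts i b) i (t' := c) (by simpa using hbc)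
    simpa using this

theorem qcongr {n m : ℕ} {R : Set (QT_s13 n × QT_s13 n)} (F : (QLang n).Functions m)
    (ts ts' : Fin m → QT_s13 n) (h : ∀ i, Relation.ReflTransGen (Rw R) (ts i) (ts' i)) :
    Relation.ReflTransGen (Rw R) (Term.func F ts) (Term.func F ts') := by
  have key : ∀ s : Finset (Fin m),
      Relation.ReflTransGen (Rw R) (Term.func F ts) (Term.func F (s.piecewise ts' ts)) := by
    intro s
    induction s using Finset.induction_on with
    | empty => simpa using Relation.ReflTransGen.refl
    | insert i s hi ih =>
      refine ih.trans ?_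
      rw [Finset.piecewise_insert]
      apply qcongr1
      simpa [hi] using h i
  simpa using key Finset.univ

theorem rw_qnf {n : ℕ} (t : QT_s13 n) : Relation.ReflTransGen (Rw (SigmaQplus n)) t (qnf t) := by
  induction t with
  | var x => exact Relation.ReflTransGen.refl
  | @func m F ts ih =>
    refine (qcongr F ts _ ih).trans ?_
    by_cases h : ∃ r, QRoot (n := n) F (fun i => qnf (ts i)) r
    · obtain ⟨r, h⟩ := h
      rw [qnf, qred_root h]
      exact Relation.ReflTransGen.single (qroot_rw h)
    · push Not at h
      rw [qnf, qred_not h]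

theorem qnf_rws {n : ℕ} {t s : QT_s13 n} (h : Relation.ReflTransGen (Rw (SigmaQplus n)) t s) :
    qnf t = qnf s := by
  induction h with
  | refl => rfl
  | tail _ h ih => exact ih.trans (qnf_rw h)

/-- Lemma 2.3: for n ≥ 2, the system Σ_Q⁺(n) is confluent. -/
theorem stmt_13 (n : ℕ) (hn : 2 ≤ n) :
    ∀ t t₁ t₂ : (QLang n).Term ℕ,
      Relation.ReflTransGen (Rw (SigmaQplus n)) t t₁ →
      Relation.ReflTransGen (Rw (SigmaQplus n)) t t₂ →
      ∃ t' : (QLang n).Term ℕ,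
        Relation.ReflTransGen (Rw (SigmaQplus n)) t₁ t' ∧
        Relation.ReflTransGen (Rw (SigmaQplus n)) t₂ t' := by
  intro t t₁ t₂ h1 h2
  refine ⟨qnf t, ?_, ?_⟩
  · rw [qnf_rws h1]
    exact rw_qnf _
  · rw [qnf_rws h2]
    exact rw_qnf _
end
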